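/- arXiv:1107.0327 — 3 statements merged into one kernel-verified Lean document; each statement's English description precedes it below -/
import Mathlib

section
/- For every integer k ≥ 4 there exists a threshold n₀ (depending on k) such that for every integer n > n₀ there exists a set P of exactly n points in the plane ℝ² with the following two properties: (1) no line in ℝ² contains k+1 or more points of P; (2) the number of lines in ℝ² that contain exactly k points of P is greater than n^(2 − c/√(log n)), where c = 2·log(4k+9) and log denotes the base-2 logarithm. Equivalently, t_k^{(k+1)}(n) > n^(2 − c/√(log n)) for all n > n₀. -/
open Real

/-- A line in `ℝ^d` (here the plane `ℝ²`), i.e. a set of the form `{a + t • v : t ∈ ℝ}`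
with `v ≠ 0`. -/
def IsLine {d : ℕ} (L : Set (EuclideanSpace ℝ (Fin d))) : Prop :=
  ∃ a v : EuclideanSpace ℝ (Fin d), v ≠ 0 ∧ L = {x | ∃ t : ℝ, x = a + t • v}

open Finset in
theorem mk_proj {V : Type*} [AddCommGroup V] [Module ℝ V] (P : Finset V) :
    ∃ φ ψ : V →ₗ[ℝ] ℝ, (∀ a ∈ P, ∀ b ∈ P, a ≠ b → φ (b - a) ≠ 0) ∧
      ∀ a ∈ P, ∀ b ∈ P, ∀ c ∈ P, a ≠ b → φ (b - a) * ψ (c - a) = φ (c - a) * ψ (b - a) →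
        ∃ t : ℝ, c = a + t • (b - a) := by
  classical
  obtain ⟨φ, hφ⟩ := Module.exists_dual_forall_apply_ne_zero (K := ℝ)
    (ι := {x : P × P // x.1 ≠ x.2}) (fun x => (x.1.2 : V) - x.1.1) (by
      rintro ⟨⟨a, b⟩, h⟩ h0
      exact h (Subtype.ext (sub_eq_zero.1 h0).symm))
  let w : P × P × P → V := fun x => φ ((x.2.1 : V) - x.1) • ((x.2.2 : V) - x.1)
    - φ ((x.2.2 : V) - x.1) • ((x.2.1 : V) - x.1)
  obtain ⟨ψ, hψ⟩ := Module.exists_dual_forall_apply_ne_zero (K := ℝ)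
    (ι := {x : P × P × P // w x ≠ 0}) (fun x => w x.1) (fun x => x.2)
  have h1 : ∀ a ∈ P, ∀ b ∈ P, a ≠ b → φ (b - a) ≠ 0 := by
    intro a ha b hb hab
    exact hφ ⟨(⟨a, ha⟩, ⟨b, hb⟩), by simpa using hab⟩
  refine ⟨φ, ψ, h1, ?_⟩
  intro a ha b hb c hc hab h
  have hw : w (⟨a, ha⟩, ⟨b, hb⟩, ⟨c, hc⟩) = 0 := by
    by_contra hne
    refine hψ ⟨_, hne⟩ ?_
    simp only [w, map_sub, map_smul, smul_eq_mul] at h ⊢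
    linarith
  have hn := h1 a ha b hb hab
  refine ⟨φ (c - a) / φ (b - a), ?_⟩
  have h3 : φ (b - a) • (c - a) = φ (c - a) • (b - a) := sub_eq_zero.1 hw
  have h4 : c - a = (φ (c - a) / φ (b - a)) • (b - a) := by
    rw [div_eq_inv_mul, mul_smul, ← h3, smul_smul, inv_mul_cancel₀ hn, one_smul]
  rw [← h4]; abel

abbrev VV (d : ℕ) := ℝ × (Fin d → ℝ) × ℝ

def SS (k d : ℕ) (D : ℝ) : Set (VV d) :=
  {p | (∃ j : ℕ, j < k ∧ p.1 = j) ∧ p.2.2 = p.2.1 ⬝ᵥ p.2.1 - p.1 ^ 2 * D}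

theorem SS_key {k d : ℕ} {D : ℝ} {a b c : VV d} (ha : a ∈ SS k d D) (hb : b ∈ SS k d D)
    (hc : c ∈ SS k d D) (hab : a ≠ b) (h1 : a.1 = b.1) (t : ℝ) (h : c = a + t • (b - a)) :
    c = a ∨ c = b := by
  obtain ⟨a1, a2, a3⟩ := a
  obtain ⟨b1, b2, b3⟩ := b
  obtain ⟨c1, c2, c3⟩ := c
  simp only at h1
  subst h1
  obtain ⟨-, ha⟩ := ha
  obtain ⟨-, hb⟩ := hb
  obtain ⟨-, hc⟩ := hc
  simp only [Prod.mk_sub_mk, Prod.smul_mk, Prod.mk_add_mk, Prod.mk.injEq, sub_self, smul_zero,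
    add_zero, smul_eq_mul] at h ha hb hc
  obtain ⟨rfl, rfl, rfl⟩ := h
  have e : t * (1 - t) * ((b2 - a2) ⬝ᵥ (b2 - a2)) = 0 := by
    simp only [dotProduct_add, add_dotProduct, dotProduct_sub, sub_dotProduct, smul_dotProduct,
      dotProduct_smul, smul_eq_mul] at hc ⊢
    rw [ha, hb] at hc
    rw [dotProduct_comm b2 a2] at hc ⊢
    nlinarith
  rcases mul_eq_zero.1 e with e | e
  · rcases mul_eq_zero.1 e with e | e
    · left; simp [e]
    · right
      have : t = 1 := by linarith
      subst this; simp
  · exfalso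
    rw [dotProduct_self_eq_zero, sub_eq_zero] at e
    subst e
    exact hab (by rw [ha, hb])

abbrev E2 := EuclideanSpace ℝ (Fin 2)

theorem line_det {L : Set E2} (hL : IsLine L) {a b c : E2} (ha : a ∈ L) (hb : b ∈ L) (hc : c ∈ L) :
    (b 0 - a 0) * (c 1 - a 1) = (c 0 - a 0) * (b 1 - a 1) := by
  obtain ⟨o, v, hv, rfl⟩ := hL
  obtain ⟨r, rfl⟩ := ha
  obtain ⟨s, rfl⟩ := hb
  obtain ⟨t, rfl⟩ := hc
  simp only [PiLp.add_apply, PiLp.smul_apply, smul_eq_mul]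
  ring

def thru (a b : E2) : Set E2 := {x | ∃ t : ℝ, x = a + t • (b - a)}

theorem thru_isLine {a b : E2} (h : a ≠ b) : IsLine (thru a b) :=
  ⟨a, b - a, sub_ne_zero.2 h.symm, rfl⟩

theorem line_eq_thru {L : Set E2} (hL : IsLine L) {a b : E2} (ha : a ∈ L) (hb : b ∈ L)
    (hab : a ≠ b) : L = thru a b := by
  obtain ⟨o, v, hv, rfl⟩ := hL
  obtain ⟨r, rfl⟩ := ha
  obtain ⟨s, rfl⟩ := hb
  have hrs : s - r ≠ 0 := by
    intro h
    exact hab (by rw [sub_eq_zero.1 h])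
  ext x
  constructor
  · rintro ⟨t, rfl⟩
    refine ⟨(t - r) / (s - r), ?_⟩
    have : o + s • v - (o + r • v) = (s - r) • v := by rw [sub_smul]; abel
    rw [this, smul_smul, div_mul_cancel₀ _ hrs, sub_smul]; abel
  · rintro ⟨t, rfl⟩
    refine ⟨r + t * (s - r), ?_⟩
    have : o + s • v - (o + r • v) = (s - r) • v := by rw [sub_smul]; abel
    rw [this, smul_smul, add_smul]; abel

theorem lines_finite (P : Finset E2) (k : ℕ) (hk : 2 ≤ k) :
    {L : Set E2 | IsLine L ∧ (L ∩ ↑P).ncard = k}.Finite := by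
  refine ((P.finite_toSet).image2 thru (P.finite_toSet)).subset ?_
  rintro L ⟨hL, hc⟩
  obtain ⟨a, ha, b, hb, hab⟩ := (Set.one_lt_ncard_iff_nontrivial_and_finite.1
    (show 1 < (L ∩ ↑P).ncard by omega)).1
  exact ⟨a, ha.2, b, hb.2, (line_eq_thru hL ha.1 hb.1 hab).symm⟩

def qq {d R : ℕ} (x u : Fin d → Fin R) (j : ℕ) : VV d :=
  ((j : ℝ), fun i => ((x i : ℕ) : ℝ) + j * ((u i : ℕ) : ℝ),
    ∑ i, ((x i : ℕ) : ℝ) ^ 2 + 2 * j * ∑ i, ((x i : ℕ) : ℝ) * ((u i : ℕ) : ℝ))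

theorem qq_eq {d R : ℕ} (x u : Fin d → Fin R) (j : ℕ) (D : ℕ) (hD : ∑ i, (u i : ℕ) ^ 2 = D) :
    (qq x u j).2.2 = (qq x u j).2.1 ⬝ᵥ (qq x u j).2.1 - (qq x u j).1 ^ 2 * (D : ℝ) := by
  rw [← hD]
  simp only [qq, dotProduct]
  push_cast
  rw [Finset.mul_sum, Finset.mul_sum, ← Finset.sum_sub_distrib, ← Finset.sum_add_distrib]
  refine Finset.sum_congr rfl fun i _ => ?_
  ring

theorem qq_inj {d R : ℕ} {x u x' u' : Fin d → Fin R} (h0 : qq x u 0 = qq x' u' 0)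
    (h1 : qq x u 1 = qq x' u' 1) : x = x' ∧ u = u' := by
  have e0 := congrArg (fun p : VV d => p.2.1) h0
  have e1 := congrArg (fun p : VV d => p.2.1) h1
  simp only [qq] at e0 e1
  have a : ∀ i, x i = x' i := by
    intro i
    have := congrFun e0 i
    simp at this
    exact Fin.ext (by exact_mod_cast this)
  have b : ∀ i, u i = u' i := by
    intro i
    have := congrFun e1 i
    rw [a i] at this
    simp at this
    exact Fin.ext (by exact_mod_cast this)
  exact ⟨funext a, funext b⟩

theorem pigeon (d R : ℕ) (hd : 1 ≤ d) (hR : 1 ≤ R) :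
    ∃ D : ℕ, R ^ d ≤ (Finset.univ.filter fun u : Fin d → Fin R => ∑ i, (u i : ℕ) ^ 2 = D).card
      * (d * R ^ 2) := by
  by_contra! hcon
  have hm : ∀ u ∈ (Finset.univ : Finset (Fin d → Fin R)),
      ∑ i, (u i : ℕ) ^ 2 ∈ Finset.range (d * R ^ 2) := by
    intro u _
    rw [Finset.mem_range]
    have : ∑ i, (u i : ℕ) ^ 2 < ∑ i : Fin d, R ^ 2 := by
      refine Finset.sum_lt_sum_of_nonempty ⟨⟨0, hd⟩, Finset.mem_univ _⟩ fun i _ => ?_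
      exact Nat.pow_lt_pow_left (u i).2 (by norm_num)
    simpa using this
  have h1 := Finset.card_eq_sum_card_fiberwise hm
  have hpos : 0 < d * R ^ 2 := by positivity
  have h2 : ∑ D ∈ Finset.range (d * R ^ 2), (Finset.univ.filter
      fun u : Fin d → Fin R => ∑ i, (u i : ℕ) ^ 2 = D).card * (d * R ^ 2)
      < ∑ D ∈ Finset.range (d * R ^ 2), R ^ d :=
    Finset.sum_lt_sum_of_nonempty ⟨0, Finset.mem_range.2 hpos⟩ fun D _ => hcon D
  rw [← Finset.sum_mul, ← h1] at h2
  simp only [Finset.card_univ, Fintype.card_pi, Fintype.card_fin, Finset.prod_const,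
    Finset.sum_const, Finset.card_range, smul_eq_mul] at h2
  rw [mul_comm] at h2
  exact lt_irrefl _ h2

theorem SS_infinite (k d : ℕ) (D : ℝ) (hk : 1 ≤ k) (hd : 1 ≤ d) : (SS k d D).Infinite := by
  refine Set.infinite_of_injective_forall_mem
    (f := fun m : ℕ => ((0, fun _ => (m : ℝ), (fun _ : Fin d => (m : ℝ)) ⬝ᵥ (fun _ => (m : ℝ))) : VV d)) ?_ ?_
  · intro m m' h
    have e := congrArg (fun p : VV d => p.2.1 ⟨0, hd⟩) h
    simpa using e
  · intro m
    exact ⟨⟨0, hk, by simp⟩, by simp⟩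

theorem construct (k d R n : ℕ) (hk : 2 ≤ k) (hd : 1 ≤ d) (hR : 1 ≤ R)
    (hn : k * (k * R) ^ d ≤ n) :
    ∃ P : Finset E2, P.card = n ∧ (∀ L : Set E2, IsLine L → (L ∩ ↑P).ncard ≤ k) ∧
      R ^ d * R ^ d ≤ Set.ncard {L : Set E2 | IsLine L ∧ (L ∩ ↑P).ncard = k} * (d * R ^ 2) := by
  classical
  obtain ⟨D, hD⟩ := pigeon d R hd hR
  set U := Finset.univ.filter fun u : Fin d → Fin R => ∑ i, (u i : ℕ) ^ 2 = D with hU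
  -- the base points
  let g : Fin k × (Fin d → Fin (k * R)) → VV d := fun y =>
    (((y.1 : ℕ) : ℝ), fun i => ((y.2 i : ℕ) : ℝ),
      (fun i => ((y.2 i : ℕ) : ℝ)) ⬝ᵥ (fun i => ((y.2 i : ℕ) : ℝ)) - ((y.1 : ℕ) : ℝ) ^ 2 * (D : ℝ))
  have hg : Set.range g ⊆ SS k d D := by
    rintro _ ⟨y, rfl⟩
    exact ⟨⟨y.1, y.1.2, rfl⟩, rfl⟩
  have hcard : (Set.range g).ncard ≤ n := by
    refine le_trans ?_ hn
    rw [← Set.image_univ]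
    refine (Set.ncard_image_le Set.finite_univ).trans ?_
    simp [Set.ncard_univ, Nat.card_eq_fintype_card]
  obtain ⟨P', hgP, hPS, hPc⟩ := (SS_infinite k d D (by omega) hd).exists_superset_ncard_eq hg
    (Set.finite_range g) hcard
  have hn0 : 0 < n := lt_of_lt_of_le (by positivity) hn
  have hfin : P'.Finite := Set.finite_of_ncard_pos (by omega)
  obtain ⟨P, rfl⟩ := hfin.exists_finset_coe
  rw [Set.ncard_coe_finset] at hPc
  obtain ⟨φ, ψ, hφ, hφψ⟩ := mk_proj P
  let f : VV d → E2 := fun p => !₂[φ p, ψ p]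
  have finj : Set.InjOn f P := by
    intro a ha b hb hab
    by_contra hne
    apply hφ a ha b hb hne
    have := congrArg (fun v : E2 => v 0) hab
    simp only [f] at this
    simp at this
    rw [map_sub, this, sub_self]
  have hqP : ∀ (x u : Fin d → Fin R), u ∈ U → ∀ j < k, qq x u j ∈ P := by
    intro x u hu j hj
    apply hgP
    have hlt : ∀ i, (x i : ℕ) + j * (u i : ℕ) < k * R := by
      intro i
      have h1 := (x i).2
      have h2 := (u i).2
      have h3 : j * (u i : ℕ) ≤ (k - 1) * R := Nat.mul_le_mul (by omega) h2.le
      obtain ⟨m, rfl⟩ : ∃ m, k = m + 1 := ⟨k - 1, by omega⟩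
      simp only [Nat.add_sub_cancel] at h3
      nlinarith
    refine ⟨(⟨j, hj⟩, fun i => ⟨(x i : ℕ) + j * (u i : ℕ), hlt i⟩), ?_⟩
    have e := qq_eq x u j D (Finset.mem_filter.1 hu).2
    refine Prod.ext rfl (Prod.ext ?_ ?_)
    · funext i; simp [g, qq]
    · rw [e]; simp [g, qq]
  have hcol : ∀ L : Set E2, IsLine L → ∀ a ∈ P, ∀ b ∈ P, ∀ c ∈ P, a ≠ b → f a ∈ L → f b ∈ L →
      f c ∈ L → ∃ t : ℝ, c = a + t • (b - a) := by
    intro L hL a ha b hb c hc hab h1 h2 h3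
    apply hφψ a ha b hb c hc hab
    have := line_det hL h1 h2 h3
    simpa [f] using this
  have hLP : ∀ L : Set E2, L ∩ ↑(P.image f) = f '' ↑(P.filter fun p => f p ∈ L) := by
    intro L
    ext y
    simp only [Set.mem_inter_iff, Finset.coe_image, Set.mem_image, Finset.mem_coe,
      Finset.mem_filter]
    constructor
    · rintro ⟨h, p, hp, rfl⟩
      exact ⟨p, ⟨hp, h⟩, rfl⟩
    · rintro ⟨p, ⟨hp, h⟩, rfl⟩
      exact ⟨h, p, hp, rfl⟩
  have hLc : ∀ L : Set E2, (L ∩ ↑(P.image f)).ncard = (P.filter fun p => f p ∈ L).card := by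
    intro L
    rw [hLP, Set.InjOn.ncard_image (finj.mono (by
      intro p hp; exact (Finset.mem_filter.1 hp).1)), Set.ncard_coe_finset]
  have hle : ∀ L : Set E2, IsLine L → (P.filter fun p => f p ∈ L).card ≤ k := by
    intro L hL
    set T := P.filter fun p => f p ∈ L with hT
    by_cases hi : Set.InjOn (fun p : VV d => p.1) T
    · rw [← Finset.card_image_of_injOn hi]
      refine (Finset.card_le_card (t := (Finset.range k).image fun j : ℕ => (j : ℝ)) ?_).trans
        (Finset.card_image_le.trans (by simp))
      intro y hy
      obtain ⟨p, hp, rfl⟩ := Finset.mem_image.1 hy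
      obtain ⟨⟨j, hj, e⟩, -⟩ := hPS (Finset.mem_filter.1 hp).1
      exact Finset.mem_image.2 ⟨j, Finset.mem_range.2 hj, e.symm⟩
    · simp only [Set.InjOn] at hi
      push Not at hi
      obtain ⟨a, ha, b, hb, e, hab⟩ := hi
      have ha' := Finset.mem_filter.1 ha
      have hb' := Finset.mem_filter.1 hb
      have : T ⊆ {a, b} := by
        intro c hc
        have hc' := Finset.mem_filter.1 hc
        obtain ⟨t, ht⟩ := hcol L hL a ha'.1 b hb'.1 c hc'.1 hab ha'.2 hb'.2 hc'.2
        simpa using SS_key (hPS ha'.1) (hPS hb'.1) (hPS hc'.1) hab e t ht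
      exact (Finset.card_le_card this).trans (Finset.card_le_two.trans hk)
  refine ⟨P.image f, ?_, ?_, ?_⟩
  · rw [Finset.card_image_of_injOn finj, hPc]
  · intro L hL
    rw [hLc]; exact hle L hL
  · have hq01 : ∀ x u : Fin d → Fin R, u ∈ U → f (qq x u 0) ≠ f (qq x u 1) := by
      intro x u hu h
      have := finj (hqP x u hu 0 (by omega)) (hqP x u hu 1 (by omega)) h
      have := congrArg (fun p : VV d => p.1) this
      simp [qq] at this
    let G : (Fin d → Fin R) × (Fin d → Fin R) → Set E2 := fun y =>
      thru (f (qq y.1 y.2 0)) (f (qq y.1 y.2 1))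
    -- the points on the line
    have hGT : ∀ x u : Fin d → Fin R, u ∈ U →
        (P.filter fun p => f p ∈ G (x, u)) = (Finset.range k).image (qq x u) := by
      intro x u hu
      symm
      apply Finset.eq_of_subset_of_card_le
      · intro p hp
        obtain ⟨j, hj, rfl⟩ := Finset.mem_image.1 hp
        rw [Finset.mem_filter]
        refine ⟨hqP x u hu j (Finset.mem_range.1 hj), (j : ℝ), ?_⟩
        have e : qq x u j = qq x u 0 + (j : ℝ) • (qq x u 1 - qq x u 0) := by
          refine Prod.ext ?_ (Prod.ext ?_ ?_)
          · simp [qq]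
          · funext i; simp [qq]
          · simp [qq]; ring
        rw [e]
        ext i
        fin_cases i <;> simp [f]
      · rw [Finset.card_image_of_injective, Finset.card_range]
        · exact hle _ (thru_isLine (hq01 x u hu))
        · intro j j' h
          have := congrArg (fun p : VV d => p.1) h
          simpa [qq] using this
    have hmain : ((Finset.univ : Finset (Fin d → Fin R)) ×ˢ U).card ≤
        Set.ncard {L : Set E2 | IsLine L ∧ (L ∩ ↑(P.image f)).ncard = k} := by
      rw [← Set.ncard_coe_finset]
      refine Set.ncard_le_ncard_of_injOn G ?_ ?_ (lines_finite _ k hk)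
      · rintro ⟨x, u⟩ hxu
        have hu : u ∈ U := (Finset.mem_product.1 hxu).2
        refine ⟨thru_isLine (hq01 x u hu), ?_⟩
        rw [hLc, hGT x u hu, Finset.card_image_of_injective, Finset.card_range]
        intro j j' h
        have := congrArg (fun p : VV d => p.1) h
        simpa [qq] using this
      · rintro ⟨x, u⟩ hxu ⟨x', u'⟩ hxu' h
        have hu : u ∈ U := (Finset.mem_product.1 hxu).2
        have hu' : u' ∈ U := (Finset.mem_product.1 hxu').2
        have e : (Finset.range k).image (qq x u) = (Finset.range k).image (qq x' u') := by
          rw [← hGT x u hu, ← hGT x' u' hu', h]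
        have key : ∀ j < k, qq x u j = qq x' u' j := by
          intro j hj
          have : qq x u j ∈ (Finset.range k).image (qq x' u') := by
            rw [← e]; exact Finset.mem_image_of_mem _ (Finset.mem_range.2 hj)
          obtain ⟨j', hj', e'⟩ := Finset.mem_image.1 this
          have h1 := congrArg (fun p : VV d => p.1) e'
          have : j' = j := by simpa [qq] using h1
          rw [← e', this]
        obtain ⟨rfl, rfl⟩ := qq_inj (key 0 (by omega)) (key 1 (by omega))
        rfl
    rw [Finset.card_product] at hmain
    have : (Finset.univ : Finset (Fin d → Fin R)).card = R ^ d := by simp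
    rw [this] at hmain
    calc R ^ d * R ^ d ≤ R ^ d * (U.card * (d * R ^ 2)) := Nat.mul_le_mul_left _ hD
      _ = (R ^ d * U.card) * (d * R ^ 2) := by ring
      _ ≤ _ := Nat.mul_le_mul_right _ hmain

theorem ev_ineq (k : ℕ) (hk : 4 ≤ k) : ∀ᶠ l : ℝ in Filter.atTop,
    4 * (k : ℝ) ^ 4 * (l + 1) * (4 * (k : ℝ)) ^ (2 * l) ≤ (4 * (k : ℝ) + 9) ^ (2 * l) := by
  have hk0 : (0 : ℝ) < k := by positivity
  set b : ℝ := 2 * Real.log ((4 * k + 9) / (4 * k)) with hb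
  have hb0 : 0 < b := by
    have : 1 < ((4 * k + 9) / (4 * k) : ℝ) := by
      rw [one_lt_div (by positivity)]; linarith
    have := Real.log_pos this
    positivity
  have h := (isLittleO_pow_exp_pos_mul_atTop 1 hb0).def
    (show (0 : ℝ) < 1 / (8 * (k : ℝ) ^ 4) by positivity)
  filter_upwards [h, Filter.eventually_ge_atTop (1 : ℝ)] with l hl hl1
  have e : (4 * (k : ℝ) + 9) ^ (2 * l) = Real.exp (b * l) * (4 * (k : ℝ)) ^ (2 * l) := by
    have : (4 * (k : ℝ) + 9) = ((4 * k + 9) / (4 * k)) * (4 * k) := by field_simp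
    conv_lhs => rw [this]
    rw [Real.mul_rpow (by positivity) (by positivity), Real.rpow_def_of_pos (by positivity), hb]
    congr 2; ring
  rw [e]
  refine mul_le_mul_of_nonneg_right ?_ (by positivity)
  rw [Real.norm_of_nonneg (by positivity), Real.norm_of_nonneg (by positivity), pow_one,
    div_mul_eq_mul_div, one_mul, le_div_iff₀ (by positivity)] at hl
  nlinarith [pow_pos hk0 4]

/-- For every integer `k ≥ 4` there is a threshold `n₀` such that for all `n > n₀` there is an
`n`-point planar set `P` with no `k+1` collinear points and more than
`n ^ (2 - c / √(log n))` lines containing exactly `k` points of `P`, where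
`c = 2 * log (4k + 9)` (base-2 logarithm). -/
theorem many_k_point_lines_no_k_plus_one (k : ℕ) (hk : 4 ≤ k) :
    ∃ n₀ : ℕ, ∀ n : ℕ, n > n₀ →
      ∃ P : Finset (EuclideanSpace ℝ (Fin 2)),
        P.card = n ∧
        (∀ L : Set (EuclideanSpace ℝ (Fin 2)), IsLine L → (L ∩ ↑P).ncard ≤ k) ∧
        ((Set.ncard {L : Set (EuclideanSpace ℝ (Fin 2)) |
            IsLine L ∧ (L ∩ ↑P).ncard = k} : ℝ) >
          (n : ℝ) ^ ((2 : ℝ) - (2 * Real.logb 2 (4 * (k : ℝ) + 9)) /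
            Real.sqrt (Real.logb 2 (n : ℝ)))) := by
  have ht : Filter.Tendsto (fun n : ℕ => Real.sqrt (Real.logb 2 (n : ℝ))) Filter.atTop
      Filter.atTop :=
    Real.tendsto_sqrt_atTop.comp
      ((Real.tendsto_logb_atTop (by norm_num)).comp tendsto_natCast_atTop_atTop)
  have hev := (ht.eventually ((ev_ineq k hk).and
    (Filter.eventually_ge_atTop ((k : ℝ) + 2)))).and (Filter.eventually_ge_atTop 1)
  obtain ⟨n₀, hn₀⟩ := Filter.eventually_atTop.1 hev
  refine ⟨n₀, fun n hn => ?_⟩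
  obtain ⟨⟨hA, hB⟩, hn1⟩ := hn₀ n hn.le
  set l := Real.sqrt (Real.logb 2 (n : ℝ)) with hl
  have hn1' : (1 : ℝ) ≤ n := by exact_mod_cast hn1
  have hk4 : (4 : ℝ) ≤ k := by exact_mod_cast hk
  have hl0 : 0 < l := by linarith
  have hl2 : l ^ 2 = Real.logb 2 n := Real.sq_sqrt (Real.logb_nonneg (by norm_num) hn1')
  have hnl : (n : ℝ) = (2 : ℝ) ^ (l ^ 2) := by
    rw [hl2, Real.rpow_logb (by norm_num) (by norm_num) (by linarith)]
  set d := ⌈l⌉₊ with hd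
  have hd1 : 1 ≤ d := Nat.one_le_ceil_iff.2 hl0
  have hdl : l ≤ d := Nat.le_ceil l
  have hdu : (d : ℝ) < l + 1 := Nat.ceil_lt_add_one hl0.le
  have hR1 : k * (k * 1) ^ d ≤ n := by
    have : (k : ℝ) * (k * 1) ^ d ≤ n := by
      have h2k : (k : ℝ) ≤ 2 ^ (k : ℝ) := by
        rw [Real.rpow_natCast]; exact_mod_cast (Nat.lt_two_pow_self).le
      calc (k : ℝ) * (k * 1) ^ d = (k : ℝ) ^ ((d + 1 : ℕ) : ℝ) := by
            rw [Real.rpow_natCast]; ring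
        _ ≤ (k : ℝ) ^ (l + 2) := by
            apply Real.rpow_le_rpow_of_exponent_le (by linarith)
            push_cast; linarith
        _ ≤ (2 ^ (k : ℝ)) ^ (l + 2) := Real.rpow_le_rpow (by positivity) h2k (by linarith)
        _ = 2 ^ ((k : ℝ) * (l + 2)) := by rw [Real.rpow_mul (by norm_num)]
        _ ≤ 2 ^ (l ^ 2) := by
            apply Real.rpow_le_rpow_of_exponent_le (by norm_num)
            nlinarith
        _ = n := hnl.symm
    exact_mod_cast this
  obtain ⟨R, hR, hRn, hRn'⟩ : ∃ R, 1 ≤ R ∧ k * (k * R) ^ d ≤ n ∧ n < k * (k * (R + 1)) ^ d := by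
    have hb : ∃ m, n < k * (k * (m + 1)) ^ d := by
      refine ⟨n, ?_⟩
      have h1 : n + 1 ≤ k * (n + 1) := Nat.le_mul_of_pos_left _ (by omega)
      have h2 : k * (n + 1) ≤ (k * (n + 1)) ^ d := Nat.le_self_pow (by omega) _
      have h3 : (k * (n + 1)) ^ d ≤ k * (k * (n + 1)) ^ d := Nat.le_mul_of_pos_left _ (by omega)
      omega
    classical
    refine ⟨Nat.find hb, ?_, ?_, Nat.find_spec hb⟩
    · rw [Nat.one_le_iff_ne_zero]
      intro h0
      have := Nat.find_spec hb
      rw [h0, zero_add] at this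
      omega
    · rcases Nat.eq_zero_or_pos (Nat.find hb) with h0 | h0
      · rw [h0, mul_zero, zero_pow (by omega), mul_zero]; omega
      · have := Nat.find_min hb (m := Nat.find hb - 1) (by omega)
        rw [Nat.sub_add_cancel h0] at this
        omega
  obtain ⟨P, hP1, hP2, hP3⟩ := construct k d R n (by omega) hd1 hR hRn
  refine ⟨P, hP1, hP2, ?_⟩
  set X := Set.ncard {L : Set (EuclideanSpace ℝ (Fin 2)) | IsLine L ∧ (L ∩ ↑P).ncard = k} with hX
  have hP3' : (R : ℝ) ^ d * R ^ d ≤ X * (d * R ^ 2) := by exact_mod_cast hP3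
  have hR' : (1 : ℝ) ≤ R := by exact_mod_cast hR
  have hn2 : (n : ℝ) < k * (2 * k) ^ d * R ^ d := by
    have h1 : (n : ℝ) < k * (k * (R + 1)) ^ d := by exact_mod_cast hRn'
    refine h1.trans_le ?_
    rw [mul_assoc, ← mul_pow]
    have : (k : ℝ) * (R + 1) ≤ 2 * k * R := by nlinarith
    gcongr
  have hRl : (R : ℝ) ≤ 2 ^ l := by
    have h1 : (k : ℝ) * (k * R) ^ d ≤ n := by exact_mod_cast hRn
    have h2 : (R : ℝ) ^ d ≤ (2 ^ l) ^ d := by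
      calc (R : ℝ) ^ d ≤ (k * R) ^ d := by
            gcongr; nlinarith
        _ ≤ k * (k * R) ^ d := le_mul_of_one_le_left (by positivity) (by linarith)
        _ ≤ n := h1
        _ = 2 ^ (l ^ 2) := hnl
        _ ≤ 2 ^ (l * d) := by
            apply Real.rpow_le_rpow_of_exponent_le (by norm_num)
            nlinarith
        _ = (2 ^ l) ^ d := by rw [Real.rpow_mul (by norm_num), Real.rpow_natCast]
    exact le_of_pow_le_pow_left₀ (by omega) (by positivity) h2
  have h2kd : (2 * (k : ℝ)) ^ d ≤ (2 * k) ^ l * (2 * k) := by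
    rw [← Real.rpow_natCast, ← Real.rpow_add_one (by positivity)]
    exact Real.rpow_le_rpow_of_exponent_le (by linarith) hdu.le
  have hbig : (4 * (k : ℝ)) ^ (2 * l) = ((2 * k) ^ l) ^ 2 * (2 ^ l) ^ 2 := by
    rw [← mul_pow, ← Real.mul_rpow (by positivity) (by norm_num), mul_comm 2 l,
      Real.rpow_mul (by positivity)]
    norm_num
    ring_nf
  have hfin : (n : ℝ) ^ 2 < X * (4 * (k : ℝ) + 9) ^ (2 * l) := by
    calc (n : ℝ) ^ 2 < ((k : ℝ) * (2 * k) ^ d * R ^ d) ^ 2 := by gcongr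
      _ = (k : ℝ) ^ 2 * ((2 * k) ^ d) ^ 2 * (R ^ d * R ^ d) := by ring
      _ ≤ (k : ℝ) ^ 2 * ((2 * k) ^ l * (2 * k)) ^ 2 * (X * (d * R ^ 2)) := by gcongr
      _ ≤ (k : ℝ) ^ 2 * ((2 * k) ^ l * (2 * k)) ^ 2 * (X * ((l + 1) * (2 ^ l) ^ 2)) := by gcongr
      _ = X * (4 * (k : ℝ) ^ 4 * (l + 1) * (4 * (k : ℝ)) ^ (2 * l)) := by rw [hbig]; ring
      _ ≤ _ := by gcongr
  have hpow : (n : ℝ) ^ ((2 * Real.logb 2 (4 * (k : ℝ) + 9)) / l) = (4 * (k : ℝ) + 9) ^ (2 * l) := by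
    rw [hnl, ← Real.rpow_mul (by norm_num)]
    have : l ^ 2 * (2 * Real.logb 2 (4 * (k : ℝ) + 9) / l)
        = Real.logb 2 (4 * (k : ℝ) + 9) * (2 * l) := by
      field_simp
    rw [this, Real.rpow_mul (by norm_num), Real.rpow_logb (by norm_num) (by norm_num) (by positivity)]
  rw [gt_iff_lt, Real.rpow_sub (by linarith), hpow, div_lt_iff₀ (by positivity)]
  exact_mod_cast hfin
end

section
/- For every integer k ≥ 4 there exists a threshold n₀ (depending on k) such that for every integer n > n₀ there exists a set P of exactly n points in the plane ℝ² such that: (1) no line contains k+1 or more points of P; and (2) there are more than n^(2 − c/√(log n)) lines ℓ (with c = 2·log(4k+9), log the base-2 logarithm) such that ℓ contains exactly k points of P and these k points form a k-term arithmetic progression on ℓ, i.e., they can be ordered as p₁, p₂, …, p_k so that p_{i+1} − p_i is the same vector for all 1 ≤ i < k. -/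
open Real

theorem gen_proj {E : Type*} [AddCommGroup E] [Module ℝ E]
    (S : Finset E) : ∃ φ : E →ₗ[ℝ] (EuclideanSpace ℝ (Fin 2)), Set.InjOn φ S ∧
      ∀ a ∈ S, ∀ b ∈ S, ∀ c ∈ S, a ≠ b → ∀ t : ℝ, φ c = φ a + t • (φ b - φ a) →
        c = a + t • (b - a) := by
  classical
  have key : ∀ T : Finset E, ∃ f : Module.Dual ℝ E, ∀ x ∈ T, x ≠ 0 → f x ≠ 0 := by
    intro T
    obtain ⟨f, hf⟩ := Module.exists_dual_forall_apply_ne_zero (K := ℝ)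
      (fun x : {x // x ∈ T.filter (· ≠ 0)} => (x : E)) (fun x => (Finset.mem_filter.1 x.2).2)
    exact ⟨f, fun x hx h0 => hf ⟨x, by simp [hx, h0]⟩⟩
  obtain ⟨g, hg⟩ := key ((S ×ˢ S).image (fun p => p.2 - p.1))
  have hg' : ∀ a ∈ S, ∀ b ∈ S, a ≠ b → g (b - a) ≠ 0 := by
    intro a ha b hb hab
    exact hg _ (Finset.mem_image.2 ⟨(a, b), by simp [ha, hb], rfl⟩) (sub_ne_zero.2 hab.symm)
  obtain ⟨f, hf⟩ := key ((S ×ˢ S ×ˢ S).image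
    (fun p => g (p.2.2 - p.1) • (p.2.1 - p.1) - g (p.2.1 - p.1) • (p.2.2 - p.1)))
  let φ : E →ₗ[ℝ] (EuclideanSpace ℝ (Fin 2)) :=
    (WithLp.linearEquiv 2 ℝ (Fin 2 → ℝ)).symm.toLinearMap ∘ₗ LinearMap.pi ![f, g]
  have h0 : ∀ x, φ x 0 = f x := fun x => by simp [φ]
  have h1 : ∀ x, φ x 1 = g x := fun x => by simp [φ]
  refine ⟨φ, ?_, ?_⟩
  · intro a ha b hb hab
    by_contra hne
    apply hg' a ha b hb hne
    rw [map_sub, ← h1, ← h1, hab, sub_self]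
  · intro a ha b hb c hc hab t ht
    have e0 : f (c - a) = t * f (b - a) := by
      have := congrArg (fun z : EuclideanSpace ℝ (Fin 2) => z 0) ht
      simp [h0] at this
      simp [this]
    have e1 : g (c - a) = t * g (b - a) := by
      have := congrArg (fun z : EuclideanSpace ℝ (Fin 2) => z 1) ht
      simp [h1] at this
      simp [this]
    have hz : g (c - a) • (b - a) - g (b - a) • (c - a) = 0 := by
      by_contra hne
      refine hf _ (Finset.mem_image.2 ⟨(a, b, c), by simp [ha, hb, hc], rfl⟩) hne ?_
      rw [map_sub, map_smul, map_smul, e0, e1]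
      simp only [smul_eq_mul]; ring
    rw [e1, mul_comm, mul_smul, ← smul_sub, smul_eq_zero] at hz
    rcases hz with hz | hz
    · exact absurd hz (hg' a ha b hb hab)
    · rw [sub_eq_zero] at hz
      rw [hz]; abel

theorem line_eq {d : ℕ} {L : Set (EuclideanSpace ℝ (Fin d))} (hL : IsLine L)
    {p q : EuclideanSpace ℝ (Fin d)} (hp : p ∈ L) (hq : q ∈ L) (hpq : p ≠ q) :
    L = {x | ∃ t : ℝ, x = p + t • (q - p)} := by
  obtain ⟨a, v, hv, rfl⟩ := hL
  obtain ⟨s, rfl⟩ := hp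
  obtain ⟨r, rfl⟩ := hq
  have hsr : r - s ≠ 0 := by
    intro h
    apply hpq
    rw [sub_eq_zero.1 h]
  ext x
  constructor
  · rintro ⟨t, rfl⟩
    refine ⟨(t - s) / (r - s), ?_⟩
    have : (t - s) / (r - s) * (r - s) = t - s := by field_simp
    rw [add_sub_add_left_eq_sub, ← sub_smul, smul_smul, this, add_assoc, ← add_smul]
    congr 2; ring
  · rintro ⟨t, rfl⟩
    refine ⟨s + t * (r - s), ?_⟩
    rw [add_sub_add_left_eq_sub, ← sub_smul, smul_smul, add_assoc, ← add_smul]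

def GoodLine (k : ℕ) (P : Finset (EuclideanSpace ℝ (Fin 2)))
    (L : Set (EuclideanSpace ℝ (Fin 2))) : Prop :=
  IsLine L ∧ (L ∩ ↑P).ncard = k ∧
            ∃ p₀ v : EuclideanSpace ℝ (Fin 2), v ≠ 0 ∧
              L ∩ ↑P = {x | ∃ i : Fin k, x = p₀ + (i : ℝ) • v}

theorem goodLine_finite (k : ℕ) (hk : 2 ≤ k) (P : Finset (EuclideanSpace ℝ (Fin 2))) :
    {L | GoodLine k P L}.Finite := by
  classical
  apply Set.Finite.subset (s := (fun p : EuclideanSpace ℝ (Fin 2) × EuclideanSpace ℝ (Fin 2) =>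
    {x | ∃ t : ℝ, x = p.1 + t • (p.2 - p.1)}) '' (↑(P ×ˢ P)))
  · exact (Finset.finite_toSet _).image _
  · rintro L ⟨hL, hc, -⟩
    obtain ⟨p, q, hp, hq, hpq⟩ := (Set.one_lt_ncard_iff (P.finite_toSet.inter_of_right L)).1
      (by omega : 1 < (L ∩ ↑P).ncard)
    exact ⟨(p, q), by simpa using ⟨hp.2, hq.2⟩, (line_eq hL hp.1 hq.1 hpq).symm⟩

theorem exists_generic (P : Finset (EuclideanSpace ℝ (Fin 2))) :
    ∃ q ∉ P, ∀ L : Set (EuclideanSpace ℝ (Fin 2)), IsLine L → q ∈ L → (L ∩ ↑P).ncard ≤ 1 := by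
  classical
  let γ : ℝ → EuclideanSpace ℝ (Fin 2) := fun t => !₂[t, t ^ 2]
  have hγ0 : ∀ t, γ t 0 = t := fun t => by simp [γ]
  have hγ1 : ∀ t, γ t 1 = t ^ 2 := fun t => by simp [γ]
  have hγinj : Function.Injective γ := fun s t h => by rw [← hγ0 s, h, hγ0]
  have hline : ∀ a v : EuclideanSpace ℝ (Fin 2), v ≠ 0 → {t | ∃ s : ℝ, γ t = a + s • v}.Finite := by
    intro a v hv
    let p : Polynomial ℝ := Polynomial.C (v 0) * (Polynomial.X ^ 2 - Polynomial.C (a 1)) -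
      Polynomial.C (v 1) * (Polynomial.X - Polynomial.C (a 0))
    have hp : p ≠ 0 := by
      intro h
      have h2 : p.coeff 2 = 0 := by rw [h]; simp
      have h1 : p.coeff 1 = 0 := by rw [h]; simp
      have e2 : v 0 = 0 := by
        simpa [p, Polynomial.coeff_X, Polynomial.coeff_C] using h2
      have e1 : v 1 = 0 := by
        simpa [p, Polynomial.coeff_X, Polynomial.coeff_C, Polynomial.coeff_X_pow] using h1
      apply hv
      ext i
      fin_cases i <;> simp [e1, e2]
    refine (p.roots.toFinset.finite_toSet).subset ?_
    rintro t ⟨s, hs⟩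
    have e0 := congrArg (fun z : EuclideanSpace ℝ (Fin 2) => z 0) hs
    have e1 := congrArg (fun z : EuclideanSpace ℝ (Fin 2) => z 1) hs
    simp only [hγ0, hγ1, PiLp.add_apply, PiLp.smul_apply, smul_eq_mul] at e0 e1
    simp only [Finset.mem_coe, Multiset.mem_toFinset]
    rw [Polynomial.mem_roots hp]
    simp only [p, Polynomial.IsRoot, Polynomial.eval_sub, Polynomial.eval_mul, Polynomial.eval_C,
      Polynomial.eval_pow, Polynomial.eval_X]
    rw [e1, e0]; ring
  have hbad : ({t | γ t ∈ P} ∪ ⋃ p ∈ P, ⋃ q ∈ P, {t | p ≠ q ∧ ∃ s : ℝ, γ t = p + s • (q - p)}).Finite := by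
    apply Set.Finite.union
    · exact P.finite_toSet.preimage hγinj.injOn
    · refine P.finite_toSet.biUnion fun p _ => P.finite_toSet.biUnion fun q _ => ?_
      by_cases h : p = q
      · simp [h]
      · exact (hline p (q - p) (sub_ne_zero.2 (Ne.symm h))).subset fun t ht => ht.2
  obtain ⟨t, ht⟩ := hbad.exists_notMem
  simp only [Set.mem_union, Set.mem_iUnion, not_or, not_exists, Set.mem_ofPred_eq] at ht
  refine ⟨γ t, ht.1, fun L hL hq => ?_⟩
  by_contra hlt
  obtain ⟨p, q, hp, hq', hpq⟩ := (Set.one_lt_ncard_iff (P.finite_toSet.inter_of_right L)).1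
      (by omega : 1 < (L ∩ ↑P).ncard)
  rw [line_eq hL hp.1 hq'.1 hpq] at hq
  obtain ⟨s, hs⟩ := hq
  exact ht.2 p hp.2 q hq'.2 ⟨hpq, s, hs⟩

theorem pad (k : ℕ) (hk : 2 ≤ k) (P : Finset (EuclideanSpace ℝ (Fin 2)))
    (hP : ∀ L : Set (EuclideanSpace ℝ (Fin 2)), IsLine L → (L ∩ ↑P).ncard ≤ k) (n : ℕ) (hn : P.card ≤ n) :
    ∃ P' : Finset (EuclideanSpace ℝ (Fin 2)), P'.card = n ∧
      (∀ L : Set (EuclideanSpace ℝ (Fin 2)), IsLine L → (L ∩ ↑P').ncard ≤ k) ∧ ∀ L, GoodLine k P L → GoodLine k P' L := by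
  classical
  induction n, hn using Nat.le_induction with
  | base => exact ⟨P, rfl, hP, fun L h => h⟩
  | succ n hn ih =>
    obtain ⟨P', hc, hl, hg⟩ := ih
    obtain ⟨q, hq, hqL⟩ := exists_generic P'
    refine ⟨insert q P', by rw [Finset.card_insert_of_notMem hq, hc], ?_, ?_⟩
    · intro L hL
      by_cases h : q ∈ L
      · rw [Finset.coe_insert, Set.inter_insert_of_mem h]
        have := Set.ncard_insert_le q (L ∩ ↑P')
        have := hqL L hL h
        omega
      · rw [Finset.coe_insert, Set.inter_insert_of_notMem h]
        exact hl L hL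
    · intro L hL
      have h2 := hg L hL
      have h : q ∉ L := by
        intro h
        have := hqL L h2.1 h
        have := h2.2.1
        omega
      unfold GoodLine
      rw [Finset.coe_insert, Set.inter_insert_of_notMem h]
      exact h2
def hgt {F : Type*} [NormedAddCommGroup F] (p : F × ℝ) : ℝ := p.2 - ‖p.1‖ ^ 2

theorem hgt_line {F : Type*} [NormedAddCommGroup F] [InnerProductSpace ℝ F] (a b : F × ℝ) (t : ℝ)
    (hab : hgt a = hgt b) :
    hgt (a + t • (b - a)) = hgt a + t * (1 - t) * ‖b.1 - a.1‖ ^ 2 := by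
  have h1 : ‖b.1‖ ^ 2 = ‖a.1‖ ^ 2 + 2 * inner ℝ a.1 (b.1 - a.1) + ‖b.1 - a.1‖ ^ 2 := by
    rw [← norm_add_sq_real]; congr 2; abel
  have h2 : ‖a.1 + t • (b.1 - a.1)‖ ^ 2
      = ‖a.1‖ ^ 2 + 2 * (t * inner ℝ a.1 (b.1 - a.1)) + t ^ 2 * ‖b.1 - a.1‖ ^ 2 := by
    rw [norm_add_sq_real, inner_smul_right, norm_smul, mul_pow, Real.norm_eq_abs, sq_abs]
  unfold hgt at *
  simp only [Prod.fst_add, Prod.snd_add, Prod.smul_fst, Prod.smul_snd, Prod.fst_sub, Prod.snd_sub,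
    smul_eq_mul]
  rw [h2]
  have : b.2 = a.2 - ‖a.1‖ ^ 2 + ‖b.1‖ ^ 2 := by linarith
  rw [this, h1]; ring

theorem hgt_ne {F : Type*} [NormedAddCommGroup F] (a b : F × ℝ)
    (hab : hgt a = hgt b) (hne : a ≠ b) : 0 < ‖b.1 - a.1‖ ^ 2 := by
  have : b.1 - a.1 ≠ 0 := by
    intro h
    have h1 := sub_eq_zero.1 h
    apply hne
    unfold hgt at hab
    rw [h1] at hab
    exact Prod.ext h1.symm (by linarith)
  positivity

def Coll {F : Type*} [NormedAddCommGroup F] [InnerProductSpace ℝ F] (Q : Finset (F × ℝ)) : Prop :=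
  ∀ a ∈ Q, ∀ b ∈ Q, ∀ c ∈ Q, a ≠ b → ∃ t : ℝ, c = a + t • (b - a)

open Classical in
theorem fiber_le {F : Type*} [NormedAddCommGroup F] [InnerProductSpace ℝ F] (Q : Finset (F × ℝ))
    (hQ : Coll Q) (o : ℝ) : (Q.filter (fun p => hgt p = o)).card ≤ 2 := by
  by_contra! h
  obtain ⟨a, b, c, ha, hb, hc, hab, hac, hbc⟩ := Finset.two_lt_card_iff.1 h
  rw [Finset.mem_filter] at ha hb hc
  obtain ⟨t, rfl⟩ := hQ a ha.1 b hb.1 c hc.1 hab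
  have e := hgt_line a b t (ha.2.trans hb.2.symm)
  have hp := hgt_ne a b (ha.2.trans hb.2.symm) hab
  rw [hc.2, ha.2] at e
  have h0 : t * (1 - t) * ‖b.1 - a.1‖ ^ 2 = 0 := by linarith
  rcases mul_eq_zero.1 h0 with h0 | h0
  · rcases mul_eq_zero.1 h0 with h0 | h0
    · apply hac; rw [h0]; simp
    · apply hbc
      have : t = 1 := by linarith
      rw [this]; simp
  · linarith

theorem coll_card {F : Type*} [NormedAddCommGroup F] [InnerProductSpace ℝ F] (Q : Finset (F × ℝ))
    (hQ : Coll Q) (m k : ℕ) (hk : 2 ≤ k) (l : ℝ) (hl : 0 < l)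
    (hcl : ∀ p ∈ Q, ∃ j < m, hgt p = j * (2 * m - 1 - j) * l)
    (hcase : k = 2 * m ∨ (k + 1 = 2 * m ∧ ∀ a ∈ Q, ∀ b ∈ Q, hgt a = 0 → hgt b = 0 →
      ‖b.1 - a.1‖ ^ 2 < 4 * l)) : Q.card ≤ k := by
  classical
  let o : ℕ → ℝ := fun j => j * (2 * m - 1 - j) * l
  rcases hcase with hcase | ⟨hcase, hsmall⟩
  · have := Finset.card_le_mul_card_image_of_maps_to (s := Q) (f := hgt)
      (t := (Finset.range m).image o) (by
        intro p hp
        obtain ⟨j, hj, e⟩ := hcl p hp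
        exact Finset.mem_image.2 ⟨j, Finset.mem_range.2 hj, e.symm⟩) 2 (fun b _ => fiber_le Q hQ b)
    have h2 : ((Finset.range m).image o).card ≤ m := by
      simpa using Finset.card_image_le (s := Finset.range m) (f := o)
    omega
  · rw [← Finset.card_filter_add_card_filter_not (s := Q) (fun p => hgt p = 0)]
    have hR : (Q.filter (fun p => ¬ hgt p = 0)).card ≤ 2 * (m - 1) := by
      have := Finset.card_le_mul_card_image_of_maps_to (s := Q.filter (fun p => ¬ hgt p = 0)) (f := hgt)
        (t := (Finset.Ico 1 m).image o) (by
          intro p hp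
          rw [Finset.mem_filter] at hp
          obtain ⟨j, hj, e⟩ := hcl p hp.1
          refine Finset.mem_image.2 ⟨j, Finset.mem_Ico.2 ⟨?_, hj⟩, e.symm⟩
          by_contra h0
          apply hp.2
          have : j = 0 := by omega
          rw [e, this]; simp) 2 (fun b _ => fiber_le _ (by
            intro a ha b hb c hc
            exact hQ a (Finset.mem_filter.1 ha).1 b (Finset.mem_filter.1 hb).1 c (Finset.mem_filter.1 hc).1) b)
      have h2 : ((Finset.Ico 1 m).image o).card ≤ m - 1 := by
        simpa using Finset.card_image_le (s := Finset.Ico 1 m) (f := o)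
      omega
    have h0 := fiber_le Q hQ 0
    by_cases h1 : (Q.filter (fun p => hgt p = 0)).card ≤ 1
    · omega
    · have : (Q.filter (fun p => ¬ hgt p = 0)).card = 0 := by
        rw [Finset.card_eq_zero, Finset.filter_eq_empty_iff]
        intro c hc hc0
        obtain ⟨a, ha, b, hb, hab⟩ := Finset.one_lt_card.1 (not_le.1 h1)
        rw [Finset.mem_filter] at ha hb
        obtain ⟨t, ht⟩ := hQ a ha.1 b hb.1 c hc hab
        have e := hgt_line a b t (ha.2.trans hb.2.symm)
        rw [← ht, ha.2] at e
        have hs := hsmall a ha.1 b hb.1 ha.2 hb.2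
        obtain ⟨j, hj, ej⟩ := hcl c hc
        have hj1 : 1 ≤ j := by
          by_contra h
          have : j = 0 := by omega
          apply hc0; rw [ej, this]; simp
        have hj1' : (1 : ℝ) ≤ j := by exact_mod_cast hj1
        have hj2' : (j : ℝ) + 1 ≤ m := by exact_mod_cast hj
        have hbig : l ≤ hgt c := by
          rw [ej]
          have : (1 : ℝ) ≤ j * (2 * m - 1 - j) := by nlinarith
          nlinarith
        have : t * (1 - t) ≤ 1 / 4 := by nlinarith [sq_nonneg (t - 1 / 2)]
        nlinarith [sq_nonneg ‖b.1 - a.1‖]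
      omega

theorem plane {F : Type*} [NormedAddCommGroup F] [InnerProductSpace ℝ F] (k : ℕ) (hk : 2 ≤ k)
    (S : Finset (F × ℝ)) (hS : ∀ Q ⊆ S, Coll Q → Q.card ≤ k)
    (Y : Finset ((F × ℝ) × (F × ℝ)))
    (hY : ∀ y ∈ Y, y.2 ≠ 0 ∧ ∀ i < k, y.1 + (i : ℝ) • y.2 ∈ S)
    (hinj : ∀ y ∈ Y, ∀ y' ∈ Y,
      (∀ i < k, ∃ j < k, y.1 + (i : ℝ) • y.2 = y'.1 + (j : ℝ) • y'.2) →
      (∀ i < k, ∃ j < k, y'.1 + (i : ℝ) • y'.2 = y.1 + (j : ℝ) • y.2) → y = y') :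
    ∃ P : Finset (EuclideanSpace ℝ (Fin 2)), P.card ≤ S.card ∧
      (∀ L : Set (EuclideanSpace ℝ (Fin 2)), IsLine L → (L ∩ ↑P).ncard ≤ k) ∧
      Y.card ≤ {L | GoodLine k P L}.ncard := by
  classical
  obtain ⟨φ, hφ, hc⟩ := gen_proj S
  have hbound : ∀ L : Set (EuclideanSpace ℝ (Fin 2)), IsLine L →
      (L ∩ ↑(S.image φ)).ncard ≤ k := by
    intro L hL
    have e : L ∩ ↑(S.image φ) = ↑((S.filter (fun p => φ p ∈ L)).image φ) := by
      ext x
      simp only [Set.mem_inter_iff, Finset.coe_image, Set.mem_image, Finset.mem_coe,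
        Finset.mem_filter]
      constructor
      · rintro ⟨hx, p, hp, rfl⟩
        exact ⟨p, ⟨hp, hx⟩, rfl⟩
      · rintro ⟨p, ⟨hp, hx⟩, rfl⟩
        exact ⟨hx, p, hp, rfl⟩
    rw [e, Set.ncard_coe_finset]
    refine Finset.card_image_le.trans (hS _ (Finset.filter_subset _ _) ?_)
    intro a ha b hb c hcc hab
    rw [Finset.mem_filter] at ha hb hcc
    have hne : φ a ≠ φ b := fun h => hab (hφ ha.1 hb.1 h)
    have hh := hcc.2
    rw [line_eq hL ha.2 hb.2 hne] at hh
    obtain ⟨t, ht⟩ := hh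
    exact ⟨t, hc a ha.1 b hb.1 c hcc.1 hab t ht⟩
  refine ⟨S.image φ, Finset.card_image_le, hbound, ?_⟩
  let Λ : (F × ℝ) × (F × ℝ) → Set (EuclideanSpace ℝ (Fin 2)) :=
    fun y => {x | ∃ t : ℝ, x = φ y.1 + t • φ y.2}
  have hdir : ∀ y ∈ Y, φ y.2 ≠ 0 := by
    intro y hy h0
    have h1 := (hY y hy).2 0 (by omega)
    have h2 := (hY y hy).2 1 (by omega)
    have := hφ h1 h2 (by simp [h0])
    simp at this
    exact (hY y hy).1 this
  have hline : ∀ y ∈ Y, IsLine (Λ y) := fun y hy => ⟨φ y.1, φ y.2, hdir y hy, rfl⟩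
  have hint : ∀ y ∈ Y, Λ y ∩ ↑(S.image φ) = {x | ∃ i : Fin k, x = φ y.1 + (i : ℝ) • φ y.2} ∧
      (Λ y ∩ ↑(S.image φ)).ncard = k := by
    intro y hy
    have hi : Function.Injective (fun i : Fin k => φ y.1 + (i : ℝ) • φ y.2) := by
      intro i j hij
      have h1 : ((i : ℝ) - j) • φ y.2 = 0 := by
        rw [sub_smul, sub_eq_zero]; exact add_left_cancel hij
      rcases smul_eq_zero.1 h1 with h1 | h1
      · have : (i : ℝ) = j := by linarith
        exact Fin.ext (by exact_mod_cast this)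
      · exact absurd h1 (hdir y hy)
    have hr : {x | ∃ i : Fin k, x = φ y.1 + (i : ℝ) • φ y.2} =
        Set.range (fun i : Fin k => φ y.1 + (i : ℝ) • φ y.2) := by
      ext x; simp [eq_comm]
    have hcard : (Set.range (fun i : Fin k => φ y.1 + (i : ℝ) • φ y.2)).ncard = k := by
      rw [← Set.image_univ, Set.ncard_image_of_injective _ hi, Set.ncard_univ, Nat.card_fin]
    have hsub : Set.range (fun i : Fin k => φ y.1 + (i : ℝ) • φ y.2) ⊆ Λ y ∩ ↑(S.image φ) := by
      rintro x ⟨i, rfl⟩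
      refine ⟨⟨i, rfl⟩, ?_⟩
      rw [Finset.coe_image]
      exact ⟨_, (hY y hy).2 i i.2, by simp⟩
    have heq := Set.eq_of_subset_of_ncard_le hsub (by
      rw [hcard]; exact hbound _ (hline y hy)) ((Finset.finite_toSet _).inter_of_right _)
    rw [hr, ← heq]
    exact ⟨rfl, hcard⟩
  have hsub : Λ '' ↑Y ⊆ {L | GoodLine k (S.image φ) L} := by
    rintro L ⟨y, hy, rfl⟩
    exact ⟨hline y hy, (hint y hy).2, φ y.1, φ y.2, hdir y hy, (hint y hy).1⟩
  have hΛ : Set.InjOn Λ ↑Y := by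
    have key : ∀ y ∈ Y, ∀ y' ∈ Y, Λ y = Λ y' →
        ∀ i < k, ∃ j < k, y.1 + (i : ℝ) • y.2 = y'.1 + (j : ℝ) • y'.2 := by
      intro y hy y' hy' h i hi
      have h1 := (hint y hy).1
      rw [h, (hint y' hy').1] at h1
      have : φ (y.1 + (i : ℝ) • y.2) ∈ {x | ∃ i : Fin k, x = φ y.1 + (i : ℝ) • φ y.2} :=
        ⟨⟨i, hi⟩, by simp⟩
      rw [← h1] at this
      obtain ⟨j, hj⟩ := this
      refine ⟨j, j.2, hφ ((hY y hy).2 i hi) ((hY y' hy').2 j j.2) ?_⟩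
      rw [hj]; simp
    intro y hy y' hy' h
    exact hinj y hy y' hy' (key y hy y' hy' h) (key y' hy' y hy h.symm)
  calc Y.card = (Λ '' ↑Y).ncard := by rw [hΛ.ncard_image, Set.ncard_coe_finset]
    _ ≤ _ := Set.ncard_le_ncard hsub (goodLine_finite k hk _)

def toE {d : ℕ} (x : Fin d → ℕ) : EuclideanSpace ℝ (Fin d) := WithLp.toLp 2 (fun i => (x i : ℝ))

theorem toE_apply {d : ℕ} (x : Fin d → ℕ) (i : Fin d) : toE x i = x i := rfl

theorem toE_inj {d : ℕ} {x y : Fin d → ℕ} (h : toE x = toE y) : x = y := by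
  funext i
  have := congrArg (fun z : EuclideanSpace ℝ (Fin d) => z i) h
  simpa [toE_apply] using this

theorem toE_add {d : ℕ} (x w : Fin d → ℕ) (i : ℕ) :
    toE (fun c => x c + i * w c) = toE x + (i : ℝ) • toE w := by
  ext c; simp [toE_apply]

theorem core (k d V : ℕ) (hk : 2 ≤ k) (hd : 1 ≤ d) (hV : 1 ≤ V) :
    ∃ P : Finset (EuclideanSpace ℝ (Fin 2)), P.card ≤ k * (2 * k * V) ^ d ∧
      (∀ L : Set (EuclideanSpace ℝ (Fin 2)), IsLine L → (L ∩ ↑P).ncard ≤ k) ∧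
      (2 * V) ^ d * V ^ d ≤ {L | GoodLine k P L}.ncard * (4 * d * V ^ 2) := by
  classical
  obtain ⟨m, hm⟩ : ∃ m, k = 2 * m ∨ k + 1 = 2 * m := ⟨(k + 1) / 2, by omega⟩
  let box : ℕ → Finset (Fin d → ℕ) := fun B => Fintype.piFinset (fun _ => Finset.range B)
  let W : Finset (Fin d → ℕ) := Fintype.piFinset (fun _ => Finset.Ico V (2 * V))
  have hmemW : ∀ w, w ∈ W ↔ ∀ i, V ≤ w i ∧ w i < 2 * V := fun w => by simp [W]
  have hmemB : ∀ B x, x ∈ box B ↔ ∀ i, x i < B := fun B x => by simp [box]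
  have hWcard : W.card = V ^ d := by
    simp [W]; congr 1; omega
  have hBcard : ∀ B, (box B).card = B ^ d := fun B => by simp [box]
  let q : (Fin d → ℕ) → ℕ := fun w => ∑ i, w i ^ 2
  -- pigeonhole
  obtain ⟨l, hl⟩ : ∃ l, V ^ d ≤ (W.filter (fun w => q w = l)).card * (4 * d * V ^ 2) := by
    by_contra! h
    have hmaps : ∀ w ∈ W, q w ∈ Finset.range (4 * d * V ^ 2) := by
      intro w hw
      rw [hmemW] at hw
      rw [Finset.mem_range]
      calc q w < ∑ _i : Fin d, (2 * V) ^ 2 := by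
            apply Finset.sum_lt_sum_of_nonempty ⟨⟨0, hd⟩, Finset.mem_univ _⟩
            intro i _
            exact Nat.pow_lt_pow_left (hw i).2 (by norm_num)
        _ = 4 * d * V ^ 2 := by simp; ring
    obtain ⟨l, -, hl⟩ := Finset.exists_le_of_sum_le (s := Finset.range (4 * d * V ^ 2))
      (f := fun _ => V ^ d) (g := fun l => (W.filter (fun w => q w = l)).card * (4 * d * V ^ 2))
      ⟨0, by rw [Finset.mem_range]; positivity⟩ (by
        rw [← Finset.sum_mul, ← Finset.card_eq_sum_card_fiberwise hmaps, hWcard]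
        simp [mul_comm])
    exact absurd hl (not_le.2 (h l))
  let Wl := W.filter (fun w => q w = l)
  have hnorm : ∀ w, ‖toE w‖ ^ 2 = (q w : ℝ) := by
    intro w
    rw [EuclideanSpace.norm_sq_eq]
    simp [toE_apply, q]
  have hWlne : Wl.Nonempty := by
    rw [← Finset.card_pos]
    rcases Nat.eq_zero_or_pos Wl.card with h | h
    · rw [show (W.filter (fun w => q w = l)).card = 0 from h] at hl
      have : 0 < V ^ d := by positivity
      omega
    · exact h
  have hlbig : d * V ^ 2 ≤ l := by
    obtain ⟨w, hw⟩ := hWlne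
    obtain ⟨hw0, hwl⟩ := Finset.mem_filter.1 hw
    rw [hmemW] at hw0
    rw [← hwl]
    calc d * V ^ 2 = ∑ _i : Fin d, V ^ 2 := by simp
      _ ≤ q w := Finset.sum_le_sum fun i _ => Nat.pow_le_pow_left (hw0 i).1 2
  have hlbig' : (d : ℝ) * V ^ 2 ≤ l := by exact_mod_cast hlbig
  have hdr : (1 : ℝ) ≤ d := by exact_mod_cast hd
  have hVr : (1 : ℝ) ≤ V := by exact_mod_cast hV
  have hlpos : (0 : ℝ) < l := lt_of_lt_of_le (by positivity) hlbig'
  let ι : (Fin d → ℕ) × ℕ → EuclideanSpace ℝ (Fin d) × ℝ :=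
    fun p => (toE p.1, ‖toE p.1‖ ^ 2 + p.2 * (2 * m - 1 - p.2) * l)
  have hι : ∀ p, hgt (ι p) = p.2 * (2 * m - 1 - p.2) * l := by
    intro p; simp [hgt, ι]
  let S0 := (box (2 * k * V) ×ˢ Finset.range m).filter
    (fun p => k = 2 * m ∨ p.2 ≠ 0 ∨ ∀ i, p.1 i < 2 * V)
  let S := S0.image ι
  have hScard : S.card ≤ k * (2 * k * V) ^ d := by
    calc S.card ≤ S0.card := Finset.card_image_le
      _ ≤ (box (2 * k * V) ×ˢ Finset.range m).card := Finset.card_filter_le _ _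
      _ = (2 * k * V) ^ d * m := by rw [Finset.card_product, hBcard, Finset.card_range]
      _ ≤ (2 * k * V) ^ d * k := Nat.mul_le_mul_left _ (by omega)
      _ = _ := mul_comm _ _
  let mk : (Fin d → ℕ) × (Fin d → ℕ) →
      (EuclideanSpace ℝ (Fin d) × ℝ) × (EuclideanSpace ℝ (Fin d) × ℝ) :=
    fun p => ((toE p.1, ‖toE p.1‖ ^ 2),
      (toE p.2, 2 * inner ℝ (toE p.1) (toE p.2) + (2 * m - 1) * l))
  have hmkinj : Function.Injective mk := by
    rintro ⟨x, w⟩ ⟨x', w'⟩ h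
    simp only [mk, Prod.mk.injEq] at h
    exact Prod.ext (toE_inj h.1.1) (toE_inj h.2.1)
  let Y := (box (2 * V) ×ˢ Wl).image mk
  have hYcard : Y.card = (2 * V) ^ d * Wl.card := by
    rw [Finset.card_image_of_injective _ hmkinj, Finset.card_product, hBcard]
  have hpt : ∀ x w, q w = l → ∀ i : ℕ, (mk (x, w)).1 + (i : ℝ) • (mk (x, w)).2 =
      (toE (fun c => x c + i * w c), ‖toE (fun c => x c + i * w c)‖ ^ 2 + i * (2 * m - 1 - i) * l) := by
    intro x w hw i
    have hwn := hnorm w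
    rw [hw] at hwn
    rw [toE_add, norm_add_sq_real, inner_smul_right, norm_smul, mul_pow, hwn, Real.norm_eq_abs, sq_abs]
    refine Prod.ext rfl ?_
    simp only [mk, Prod.snd_add, Prod.smul_snd, smul_eq_mul]
    ring
  refine Exists.elim (plane k hk S ?_ Y ?_ ?_) ?_
  rotate_left 3
  · rintro P ⟨hP1, hP2, hP3⟩
    refine ⟨P, hP1.trans hScard, hP2, ?_⟩
    calc (2 * V) ^ d * V ^ d ≤ (2 * V) ^ d * (Wl.card * (4 * d * V ^ 2)) := Nat.mul_le_mul_left _ hl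
      _ = Y.card * (4 * d * V ^ 2) := by rw [hYcard]; ring
      _ ≤ _ := Nat.mul_le_mul_right _ hP3
  · intro Q hQS hQ
    refine coll_card Q hQ m k hk l hlpos ?_ ?_
    · intro p hp
      obtain ⟨p0, hp0, rfl⟩ := Finset.mem_image.1 (hQS hp)
      have := (Finset.mem_product.1 (Finset.mem_filter.1 hp0).1).2
      exact ⟨p0.2, Finset.mem_range.1 this, hι p0⟩
    · rcases hm with hm | hm
      · exact Or.inl hm
      · refine Or.inr ⟨hm, ?_⟩
        have hsm : ∀ a ∈ Q, hgt a = 0 → ∃ x : Fin d → ℕ, (∀ i, x i < 2 * V) ∧ a.1 = toE x := by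
          intro a ha h0
          obtain ⟨p0, hp0, rfl⟩ := Finset.mem_image.1 (hQS ha)
          refine ⟨p0.1, ?_, rfl⟩
          obtain ⟨h1, h2⟩ := Finset.mem_filter.1 hp0
          have hjm := Finset.mem_range.1 (Finset.mem_product.1 h1).2
          rcases h2 with h2 | h2 | h2
          · omega
          · exfalso
            rw [hι] at h0
            have hj1 : (1 : ℝ) ≤ p0.2 := by exact_mod_cast Nat.one_le_iff_ne_zero.2 h2
            have hj2 : (p0.2 : ℝ) + 1 ≤ m := by exact_mod_cast hjm
            have : (0 : ℝ) < p0.2 * (2 * m - 1 - p0.2) * l := by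
              apply mul_pos (mul_pos (by linarith) (by linarith)) hlpos
            linarith
          · exact h2
        intro a ha b hb ha0 hb0
        obtain ⟨x, hx, hxa⟩ := hsm a ha ha0
        obtain ⟨z, hz, hzb⟩ := hsm b hb hb0
        rw [hxa, hzb, EuclideanSpace.norm_sq_eq]
        calc ∑ i, ‖(toE z - toE x) i‖ ^ 2 < ∑ _i : Fin d, 4 * (V : ℝ) ^ 2 := by
              apply Finset.sum_lt_sum_of_nonempty ⟨⟨0, hd⟩, Finset.mem_univ _⟩
              intro i _
              rw [PiLp.sub_apply, toE_apply, toE_apply, Real.norm_eq_abs, sq_abs]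
              have h1 : (x i : ℝ) < 2 * V := by exact_mod_cast hx i
              have h2 : (z i : ℝ) < 2 * V := by exact_mod_cast hz i
              have h3 : (0 : ℝ) ≤ x i := Nat.cast_nonneg _
              have h4 : (0 : ℝ) ≤ z i := Nat.cast_nonneg _
              nlinarith
          _ = 4 * (d * V ^ 2) := by simp; ring
          _ ≤ 4 * l := by linarith
  · intro y hy
    obtain ⟨⟨x, w⟩, hxw, rfl⟩ := Finset.mem_image.1 hy
    obtain ⟨hx, hw⟩ := Finset.mem_product.1 hxw
    obtain ⟨hw, hwl⟩ := Finset.mem_filter.1 hw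
    simp only at hx hw hwl
    rw [hmemB] at hx
    rw [hmemW] at hw
    constructor
    · intro h0
      have h1 : toE w = 0 := congrArg Prod.fst h0
      have h2 := congrArg (fun z : EuclideanSpace ℝ (Fin d) => z ⟨0, hd⟩) h1
      simp only [toE_apply, PiLp.zero_apply, Nat.cast_eq_zero] at h2
      have := (hw ⟨0, hd⟩).1
      omega
    · intro i hi
      rw [hpt x w hwl]
      have hbx : (fun c => x c + i * w c) ∈ box (2 * k * V) := by
        rw [hmemB]
        intro c
        have h1 := hx c
        have h2 := (hw c).2
        have h3 : i * w c ≤ (k - 1) * (2 * V) := Nat.mul_le_mul (by omega) h2.le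
        obtain ⟨k', rfl⟩ : ∃ k', k = k' + 1 := ⟨k - 1, by omega⟩
        simp only [Nat.add_sub_cancel] at h3
        show x c + i * w c < _
        nlinarith
      by_cases him : i < m
      · refine Finset.mem_image.2 ⟨(fun c => x c + i * w c, i), ?_, rfl⟩
        refine Finset.mem_filter.2 ⟨Finset.mem_product.2 ⟨hbx, Finset.mem_range.2 him⟩, ?_⟩
        by_cases h0 : i = 0
        · right; right
          intro c
          simpa [h0] using hx c
        · exact Or.inr (Or.inl h0)
      · obtain ⟨j, hj⟩ : ∃ j, i + j + 1 = 2 * m := ⟨2 * m - 1 - i, by omega⟩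
        refine Finset.mem_image.2 ⟨(fun c => x c + i * w c, j), ?_, ?_⟩
        · refine Finset.mem_filter.2 ⟨Finset.mem_product.2 ⟨hbx, Finset.mem_range.2 (by
            show j < m
            omega)⟩, ?_⟩
          rcases hm with hm | hm
          · exact Or.inl hm
          · refine Or.inr (Or.inl ?_)
            show j ≠ 0
            omega
        · have : (2 * m : ℝ) = i + j + 1 := by exact_mod_cast hj.symm
          simp only [ι]
          rw [this]
          refine Prod.ext rfl ?_
          simp only
          ring
  · have key : ∀ x w x' w', w ∈ Wl → w' ∈ Wl → (∀ i < k, ∃ j < k,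
        (mk (x, w)).1 + (i : ℝ) • (mk (x, w)).2 = (mk (x', w')).1 + (j : ℝ) • (mk (x', w')).2) →
        (∀ c, x' c ≤ x c) ∧ (x = x' → ∀ c, w' c ≤ w c) := by
      intro x w x' w' hw hw' h
      obtain ⟨hw, hwl⟩ := Finset.mem_filter.1 hw
      obtain ⟨hw', hwl'⟩ := Finset.mem_filter.1 hw'
      have h' : ∀ i < k, ∃ j < k, ∀ c, x c + i * w c = x' c + j * w' c := by
        intro i hi
        obtain ⟨j, hj, e⟩ := h i hi
        rw [hpt x w hwl, hpt x' w' hwl'] at e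
        exact ⟨j, hj, fun c => congrFun (toE_inj (congrArg Prod.fst e)) c⟩
      constructor
      · intro c
        obtain ⟨j, -, e⟩ := h' 0 (by omega)
        have := e c
        nlinarith [Nat.zero_le (j * w' c)]
      · rintro rfl c
        obtain ⟨j, -, e⟩ := h' 1 (by omega)
        have e1 := e c
        rw [hmemW] at hw
        have h1 := (hw c).1
        rcases Nat.eq_zero_or_pos j with hj | hj
        · rw [hj] at e1; omega
        · nlinarith
    intro y hy y' hy' h1 h2
    obtain ⟨⟨x, w⟩, hxw, rfl⟩ := Finset.mem_image.1 hy
    obtain ⟨⟨x', w'⟩, hxw', rfl⟩ := Finset.mem_image.1 hy'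
    have hw := (Finset.mem_product.1 hxw).2
    have hw' := (Finset.mem_product.1 hxw').2
    obtain ⟨a1, a2⟩ := key x w x' w' hw hw' h1
    obtain ⟨b1, b2⟩ := key x' w' x w hw' hw h2
    have hx : x = x' := funext fun c => le_antisymm (b1 c) (a1 c)
    have hww : w = w' := funext fun c => le_antisymm (b2 hx.symm c) (a2 hx c)
    rw [hx, hww]



set_option maxHeartbeats 2000000 in
theorem asym (k : ℕ) (hk : 4 ≤ k) : ∃ n₀ : ℕ, ∀ n : ℕ, n > n₀ → ∃ d V : ℕ, 1 ≤ d ∧ 1 ≤ V ∧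
    k * (2 * k * V) ^ d ≤ n ∧ ∀ T : ℝ, ((2 * V) ^ d * V ^ d : ℝ) ≤ T * (4 * d * V ^ 2) →
      T > (n : ℝ) ^ ((2 : ℝ) - (2 * Real.logb 2 (4 * (k : ℝ) + 9)) /
            Real.sqrt (Real.logb 2 (n : ℝ))) := by
  have hk' : (4 : ℝ) ≤ k := by exact_mod_cast hk
  obtain ⟨S0, hS0⟩ : ∃ S0 : ℝ, ∀ S ≥ S0, (S + 1) * (3 * (k : ℝ) ^ 2) < (4 / 3 : ℝ) ^ S := by
    have h1 : (fun S : ℝ => (S + 1) * (3 * (k : ℝ) ^ 2)) =o[Filter.atTop]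
        (fun S : ℝ => Real.exp (Real.log (4 / 3) * S)) := by
      have hb : 0 < Real.log (4 / 3) := Real.log_pos (by norm_num)
      have hx : (fun S : ℝ => S) =o[Filter.atTop] (fun S : ℝ => Real.exp (Real.log (4 / 3) * S)) := by
        simpa using isLittleO_pow_exp_pos_mul_atTop 1 hb
      have hc : (fun S : ℝ => (1 : ℝ)) =o[Filter.atTop]
          (fun S : ℝ => Real.exp (Real.log (4 / 3) * S)) := by
        simpa using isLittleO_pow_exp_pos_mul_atTop 0 hb
      have := (hx.add hc).const_mul_left (3 * (k : ℝ) ^ 2)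
      simpa [mul_comm] using this
    have h2 := h1.def (c := 1 / 2) (by norm_num)
    obtain ⟨S0, h⟩ := Filter.eventually_atTop.1 h2
    refine ⟨S0, fun S hS => ?_⟩
    have := h S hS
    rw [Real.norm_eq_abs, Real.norm_eq_abs, abs_of_pos (Real.exp_pos _)] at this
    rw [Real.rpow_def_of_pos (by norm_num)]
    have := le_abs_self ((S + 1) * (3 * (k : ℝ) ^ 2))
    have := Real.exp_pos (Real.log (4 / 3) * S)
    linarith
  set A := Real.logb 2 (10 * k) with hA
  have hApos : 0 ≤ A := Real.logb_nonneg (by norm_num) (by linarith)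
  set S1 := max S0 (A + 2) with hS1
  refine ⟨⌈(2 : ℝ) ^ (S1 ^ 2)⌉₊, fun n hn => ?_⟩
  have hn1 : (2 : ℝ) ^ (S1 ^ 2) < n := lt_of_le_of_lt (Nat.le_ceil _) (by exact_mod_cast hn)
  have hS1pos : 0 < S1 := lt_of_lt_of_le (by linarith) (le_max_right _ _)
  have hnpos : (0 : ℝ) < n := lt_trans (by positivity) hn1
  have hlog : S1 ^ 2 < Real.logb 2 n := by
    rw [Real.lt_logb_iff_rpow_lt (by norm_num) hnpos]; exact hn1
  set S := Real.sqrt (Real.logb 2 n) with hS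
  have hSS : S1 < S := Real.lt_sqrt_of_sq_lt hlog
  have hSpos : 0 < S := hS1pos.trans hSS
  have hSsq : S ^ 2 = Real.logb 2 n := Real.sq_sqrt (le_trans (by positivity) hlog.le)
  have hnS : (n : ℝ) = 2 ^ (S ^ 2) := by
    rw [hSsq, Real.rpow_logb (by norm_num) (by norm_num) hnpos]
  set d := ⌈S⌉₊ with hd
  have hdS : S ≤ d := Nat.le_ceil _
  have hdS1 : (d : ℝ) < S + 1 := Nat.ceil_lt_add_one hSpos.le
  have hdpos : 1 ≤ d := Nat.ceil_pos.2 hSpos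
  have hdr : (0 : ℝ) < d := hSpos.trans_le hdS
  have hkpos : (0 : ℝ) < k := by linarith
  set y : ℝ := (n / k : ℝ) ^ ((1 : ℝ) / d) with hy
  have hypos : 0 < y := by positivity
  have hyd : y ^ d = n / k := by
    rw [hy, one_div, Real.rpow_inv_natCast_pow (by positivity) (by omega)]
  have hyS : y ≤ 2 ^ S := by
    calc y ≤ (n : ℝ) ^ ((1 : ℝ) / d) := by
          apply Real.rpow_le_rpow (by positivity) _ (by positivity)
          exact div_le_self hnpos.le (by linarith)
      _ = 2 ^ (S ^ 2 * (1 / d)) := by rw [hnS, ← Real.rpow_mul (by norm_num)]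
      _ ≤ 2 ^ S := by
          apply Real.rpow_le_rpow_of_exponent_le (by norm_num)
          rw [mul_one_div, div_le_iff₀ hdr]; nlinarith
  have hy10 : 10 * k ≤ y := by
    have : (10 * k : ℝ) ^ d ≤ y ^ d := by
      rw [hyd, le_div_iff₀ hkpos, hnS]
      have h10 : (10 * k : ℝ) = 2 ^ A := by
        rw [hA, Real.rpow_logb (by norm_num) (by norm_num) (by positivity)]
      calc (10 * k : ℝ) ^ d * k ≤ (10 * k : ℝ) ^ d * (10 * k) := by
            gcongr; linarith
        _ = 2 ^ (A * (d + 1)) := by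
            rw [h10, ← pow_succ, ← Real.rpow_natCast, ← Real.rpow_mul (by norm_num)]; push_cast; rfl
        _ ≤ 2 ^ (S ^ 2) := by
            apply Real.rpow_le_rpow_of_exponent_le (by norm_num)
            have : A + 2 ≤ S := (le_max_right _ _).trans hSS.le
            nlinarith
    exact le_of_pow_le_pow_left₀ (by omega) hypos.le this
  set V := ⌊y / (2 * k)⌋₊ with hV
  have hVle : (V : ℝ) ≤ y / (2 * k) := Nat.floor_le (by positivity)
  have hVlt : y / (2 * k) < V + 1 := Nat.lt_floor_add_one _
  have hV5 : 5 ≤ V := Nat.le_floor (by rw [le_div_iff₀ (by positivity)]; push_cast; linarith)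
  have hV5' : (5 : ℝ) ≤ V := by exact_mod_cast hV5
  rw [le_div_iff₀ (by positivity)] at hVle
  rw [div_lt_iff₀ (by positivity)] at hVlt
  refine ⟨d, V, hdpos, by omega, ?_, ?_⟩
  · have : (k : ℝ) * (2 * k * V) ^ d ≤ n := by
      calc (k : ℝ) * (2 * k * V) ^ d ≤ k * y ^ d := by gcongr; linarith
        _ = n := by rw [hyd]; field_simp
    exact_mod_cast this
  intro T hT
  have hpow : (n : ℝ) ^ ((2 : ℝ) - (2 * Real.logb 2 (4 * (k : ℝ) + 9)) / S)
      = n ^ 2 / ((4 * k + 9) ^ 2) ^ S := by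
    rw [Real.rpow_sub hnpos]
    congr 1
    · exact_mod_cast Real.rpow_natCast (n : ℝ) 2
    · conv_lhs => rw [hnS]
      rw [← Real.rpow_mul (by norm_num)]
      have : S ^ 2 * (2 * Real.logb 2 (4 * (k : ℝ) + 9) / S)
        = Real.logb 2 (4 * (k : ℝ) + 9) * (2 * S) := by field_simp
      rw [this, Real.rpow_mul (by norm_num), Real.rpow_logb (by norm_num) (by norm_num) (by positivity),
        Real.rpow_mul (by positivity)]
      norm_num
  rw [hpow, gt_iff_lt, div_lt_iff₀ (by positivity)]
  have hn2 : (n : ℝ) ^ 2 ≤ k ^ 2 * (6 * k ^ 2 * V ^ 2) ^ d := by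
    have e : (n : ℝ) = k * y ^ d := by rw [hyd]; field_simp
    rw [e, mul_pow, ← pow_mul, mul_comm d 2, pow_mul]
    gcongr
    have h1 : y ^ 2 ≤ ((V + 1) * (2 * k)) ^ 2 := by gcongr
    have h2 : ((V : ℝ) + 1) ^ 2 ≤ 3 / 2 * V ^ 2 := by nlinarith
    nlinarith [sq_nonneg (k : ℝ)]
  have hV2 : 4 * (k : ℝ) ^ 2 * V ^ 2 ≤ 4 ^ S := by
    calc 4 * (k : ℝ) ^ 2 * V ^ 2 = (V * (2 * k)) ^ 2 := by ring
      _ ≤ (2 ^ S) ^ 2 := by gcongr; linarith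
      _ = 4 ^ S := by
        rw [← Real.rpow_natCast, ← Real.rpow_mul (by norm_num), mul_comm, Real.rpow_mul (by norm_num)]
        norm_num
  have hmain : (d : ℝ) * 4 ^ S * (3 * k ^ 2) ^ d < ((4 * k + 9) ^ 2) ^ S := by
    have h3 : (3 * (k : ℝ) ^ 2) ^ d ≤ (3 * k ^ 2) ^ S * (3 * k ^ 2) := by
      calc (3 * (k : ℝ) ^ 2) ^ d = (3 * (k : ℝ) ^ 2) ^ (d : ℝ) := (Real.rpow_natCast _ _).symm
        _ ≤ (3 * (k : ℝ) ^ 2) ^ (S + 1) := by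
          apply Real.rpow_le_rpow_of_exponent_le _ hdS1.le
          nlinarith
        _ = _ := by rw [Real.rpow_add (by positivity), Real.rpow_one]
    calc (d : ℝ) * 4 ^ S * (3 * k ^ 2) ^ d ≤ (S + 1) * 4 ^ S * ((3 * k ^ 2) ^ S * (3 * k ^ 2)) := by
          gcongr
      _ = ((S + 1) * (3 * k ^ 2)) * (4 ^ S * (3 * k ^ 2) ^ S) := by ring
      _ < (4 / 3) ^ S * (4 ^ S * (3 * k ^ 2) ^ S) := by
          have := hS0 S ((le_max_left _ _).trans hSS.le)
          gcongr
      _ = (16 * k ^ 2) ^ S := by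
          rw [← Real.mul_rpow (by norm_num) (by positivity), ← Real.mul_rpow (by norm_num) (by positivity)]
          congr 1; ring
      _ ≤ _ := by
          apply Real.rpow_le_rpow (by positivity) _ hSpos.le
          nlinarith
  have hVp : (0 : ℝ) < V := by linarith
  have hD : (0 : ℝ) < 4 * d * V ^ 2 := by positivity
  refine lt_of_mul_lt_mul_right ?_ hD.le
  calc (n : ℝ) ^ 2 * (4 * d * V ^ 2) ≤ ((k : ℝ) ^ 2 * (6 * k ^ 2 * V ^ 2) ^ d) * (4 * d * V ^ 2) := by gcongr
    _ = ((d : ℝ) * (4 * (k : ℝ) ^ 2 * (V : ℝ) ^ 2) * (3 * (k : ℝ) ^ 2) ^ d) * ((2 * (V : ℝ)) ^ d * (V : ℝ) ^ d) := by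
        rw [show (6 * (k : ℝ) ^ 2 * V ^ 2) = (3 * (k : ℝ) ^ 2) * ((2 * V) * V) by ring, mul_pow, mul_pow (2 * (V : ℝ))]
        ring
    _ ≤ (d * 4 ^ S * (3 * k ^ 2) ^ d) * ((2 * V) ^ d * V ^ d) := by gcongr
    _ < ((4 * k + 9) ^ 2) ^ S * ((2 * V) ^ d * V ^ d) := by gcongr
    _ ≤ ((4 * k + 9) ^ 2) ^ S * (T * (4 * d * V ^ 2)) := by gcongr
    _ = _ := by ring

/-- For every integer `k ≥ 4` there is a threshold `n₀` such that for all `n > n₀` there is an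
`n`-point planar set `P` with no `k+1` collinear points and more than
`n ^ (2 - c / √(log n))` lines containing exactly `k` points of `P` which moreover form a
`k`-term arithmetic progression (the difference of consecutive points is a fixed vector),
where `c = 2 * log (4k + 9)` (base-2 logarithm). -/
theorem many_k_term_AP_lines_no_k_plus_one (k : ℕ) (hk : 4 ≤ k) :
    ∃ n₀ : ℕ, ∀ n : ℕ, n > n₀ →
      ∃ P : Finset (EuclideanSpace ℝ (Fin 2)),
        P.card = n ∧
        (∀ L : Set (EuclideanSpace ℝ (Fin 2)), IsLine L → (L ∩ ↑P).ncard ≤ k) ∧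
        ((Set.ncard {L : Set (EuclideanSpace ℝ (Fin 2)) |
            IsLine L ∧ (L ∩ ↑P).ncard = k ∧
            ∃ p₀ v : EuclideanSpace ℝ (Fin 2), v ≠ 0 ∧
              L ∩ ↑P = {x | ∃ i : Fin k, x = p₀ + (i : ℝ) • v}} : ℝ) >
          (n : ℝ) ^ ((2 : ℝ) - (2 * Real.logb 2 (4 * (k : ℝ) + 9)) /
            Real.sqrt (Real.logb 2 (n : ℝ)))) := by
  obtain ⟨n₀, h⟩ := asym k hk
  refine ⟨n₀, fun n hn => ?_⟩
  obtain ⟨d, V, hd, hV, hle, hT⟩ := h n hn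
  obtain ⟨P, hP1, hP2, hP3⟩ := core k d V (by omega) hd hV
  obtain ⟨P', hc, hl, hg⟩ := pad k (by omega) P hP2 n (hP1.trans hle)
  refine ⟨P', hc, hl, ?_⟩
  apply hT
  have h1 : {L | GoodLine k P L}.ncard ≤ {L | GoodLine k P' L}.ncard :=
    Set.ncard_le_ncard (fun L hL => hg L hL) (goodLine_finite k (by omega) P')
  have h2 := hP3.trans (Nat.mul_le_mul_right _ h1)
  have h3 : (((2 * V) ^ d * V ^ d : ℕ) : ℝ) ≤
    (({L | GoodLine k P' L}.ncard * (4 * d * V ^ 2) : ℕ) : ℝ) := by exact_mod_cast h2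
  push_cast at h3
  exact h3
end

section
/- There exists a constant c₀ > 0 such that for every integer d ≥ 3 and every real r > 4 with r² a nonnegative integer, the number of integer lattice points on the sphere of radius r in ℝ^d satisfies N(S_d(r)) ≤ 2^{c₀·log(r)/log(log(r))} · N(B_{d−2}(r)), where N(B_{d−2}(r)) is the number of integer lattice points in the closed ball of radius r in ℝ^{d−2} centered at the origin, and log denotes the base-2 logarithm. -/
open Real

lemma exists_q (p : ℕ) (hp : p.Prime) : ∃ q : GaussianInt, Prime q ∧ q ∣ (p : GaussianInt) ∧
    (q.norm = p ∨ q.norm = (p:ℤ)^2) := by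
  have hn : (Zsqrtd.norm (p : GaussianInt)) = (p:ℤ)^2 := by
    rw [Zsqrtd.norm_natCast]; ring
  have hnu : ¬ IsUnit (p : GaussianInt) := by
    intro h
    have := (Zsqrtd.norm_eq_one_iff' (by norm_num) _).2 h
    rw [hn] at this
    have h2 : p ^ 2 = 1 := by exact_mod_cast this
    have := hp.two_le
    nlinarith
  have h0 : (p : GaussianInt) ≠ 0 := by
    exact_mod_cast hp.ne_zero
  obtain ⟨q, hq, hqp⟩ := WfDvdMonoid.exists_irreducible_factor hnu h0
  refine ⟨q, hq.prime, hqp, ?_⟩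
  have hd : q.norm.natAbs ∣ p^2 := by
    obtain ⟨t, ht⟩ := hqp
    have : q.norm ∣ (p:ℤ)^2 := ⟨t.norm, by rw [← hn, ht, Zsqrtd.norm_mul]⟩
    have := Int.natAbs_dvd_natAbs.2 this
    simpa [Int.natAbs_pow] using this
  have hnn := GaussianInt.norm_nonneg q
  obtain ⟨i, hi, he⟩ := (Nat.dvd_prime_pow hp).1 hd
  have he' : q.norm = (p:ℤ)^i := by
    have := Int.natAbs_of_nonneg hnn
    rw [← this, he]; push_cast; rfl
  interval_cases i
  · exfalso
    exact hq.not_isUnit ((Zsqrtd.norm_eq_one_iff' (by norm_num) _).1 (by simpa using he'))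
  · left; simpa using he'
  · right; exact he'

lemma param (p : ℕ) (hp : p.Prime) (q : GaussianInt) (hq : Prime q)
    (hqp : q ∣ (p : GaussianInt)) (hqn : q.norm = p ∨ q.norm = (p:ℤ)^2) (k : ℕ) (hk : ¬ p ∣ k) :
    ∀ (e : ℕ) (z : GaussianInt), z.norm = ((p^e*k : ℕ) : ℤ) →
      ∃ i ≤ e, ∃ j ≤ e, ∃ w : GaussianInt, w.norm = k ∧ z = q^i * (star q)^j * w := by
  have hp0 : (p:ℤ) ≠ 0 := by exact_mod_cast hp.ne_zero
  intro e
  induction e using Nat.strong_induction_on with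
  | _ e ih =>
    intro z hz
    rcases Nat.eq_zero_or_pos e with rfl | he
    · exact ⟨0, le_rfl, 0, le_rfl, z, by simpa using hz, by simp⟩
    have key : ∀ t z' : GaussianInt, (t.norm = p ∨ t.norm = (p:ℤ)^2) → z = t * z' →
        ∃ e' < e, z'.norm = ((p^e'*k : ℕ) : ℤ) := by
      intro t z' ht hzt
      have h1 : t.norm * z'.norm = ((p^e*k : ℕ) : ℤ) := by rw [← hz, hzt, Zsqrtd.norm_mul]
      rcases ht with ht | ht
      · refine ⟨e-1, by omega, ?_⟩
        obtain ⟨f, rfl⟩ : ∃ f, e = f+1 := ⟨e-1, by omega⟩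
        rw [ht] at h1
        apply mul_left_cancel₀ hp0
        rw [h1]; simp only [Nat.add_sub_cancel]; push_cast; ring
      · rcases Nat.lt_or_ge e 2 with h | h
        · exfalso
          have : e = 1 := by omega
          subst this
          rw [ht] at h1
          have : (p:ℤ) * z'.norm = k := by
            apply mul_left_cancel₀ hp0
            push_cast at h1
            linarith
          exact hk (by exact_mod_cast Dvd.intro _ this)
        · refine ⟨e-2, by omega, ?_⟩
          obtain ⟨f, rfl⟩ : ∃ f, e = f+2 := ⟨e-2, by omega⟩
          rw [ht] at h1
          apply mul_left_cancel₀ (pow_ne_zero 2 hp0)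
          rw [h1]; simp only [Nat.add_sub_cancel]; push_cast; ring
    have hsn : (star q).norm = q.norm := Zsqrtd.norm_conj q
    have hdiv : q ∣ z * star z := by
      rw [← Zsqrtd.norm_eq_mul_conj, hz]
      refine hqp.trans ?_
      obtain ⟨f, rfl⟩ : ∃ f, e = f+1 := ⟨e-1, by omega⟩
      push_cast
      exact ⟨p^f*k, by ring⟩
    rcases hq.dvd_or_dvd hdiv with ⟨z', h⟩ | ⟨z', h⟩
    · obtain ⟨e', he', hn⟩ := key q z' hqn h
      obtain ⟨i, hi, j, hj, w, hw, hz'⟩ := ih e' he' z' hn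
      exact ⟨i+1, by omega, j, by omega, w, hw, by rw [h, hz']; ring⟩
    · have h' : z = star q * star z' := by
        rw [← star_star z, h, star_mul, mul_comm]
      obtain ⟨e', he', hn⟩ := key (star q) (star z') (by rw [hsn]; exact hqn) h'
      obtain ⟨i, hi, j, hj, w, hw, hz'⟩ := ih e' he' _ hn
      exact ⟨i, by omega, j+1, by omega, w, hw, by rw [h', hz']; ring⟩

lemma fin_norm (k : ℕ) : {z : GaussianInt | z.norm = k}.Finite := by
  refine Set.Finite.of_finite_image (f := fun z : GaussianInt => (z.re, z.im)) ?_ ?_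
  · refine ((Set.finite_Icc (-(k:ℤ)) k).prod (Set.finite_Icc (-(k:ℤ)) k)).subset ?_
    rintro _ ⟨z, hz, rfl⟩
    simp only [Set.mem_ofPred_eq, Zsqrtd.norm_def] at hz
    simp only [Set.mem_prod, Set.mem_Icc]
    refine ⟨⟨?_, ?_⟩, ?_, ?_⟩ <;> nlinarith [Int.le_self_sq z.re, Int.le_self_sq z.im, Int.le_self_sq (-z.re), Int.le_self_sq (-z.im), sq_nonneg z.re, sq_nonneg z.im]
  · intro a _ b _ h
    simp at h
    exact Zsqrtd.ext h.1 h.2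

lemma norm_count (k : ℕ) (hk : k ≠ 0) :
    {z : GaussianInt | z.norm = k}.ncard ≤ 9 * k.divisors.card ^ 2 := by
  induction k using Nat.recOnPrimePow with
  | zero => exact absurd rfl hk
  | one =>
    have hs : {z : GaussianInt | z.norm = (1:ℕ)} ⊆
        ((fun x : ℤ × ℤ => (⟨x.1, x.2⟩ : GaussianInt)) ''
          ((Finset.Icc (-1:ℤ) 1 ×ˢ Finset.Icc (-1:ℤ) 1 : Finset (ℤ × ℤ)) : Set (ℤ×ℤ))) := by
      intro z hz
      refine ⟨(z.re, z.im), ?_, rfl⟩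
      simp only [Set.mem_ofPred_eq, Zsqrtd.norm_def] at hz
      simp only [Finset.coe_product, Set.mem_prod, Finset.coe_Icc, Set.mem_Icc]
      push_cast at hz
      refine ⟨⟨?_, ?_⟩, ?_, ?_⟩ <;> nlinarith [Int.le_self_sq z.re, Int.le_self_sq z.im, Int.le_self_sq (-z.re), Int.le_self_sq (-z.im), sq_nonneg z.re, sq_nonneg z.im]
    refine (Set.ncard_le_ncard hs ((Finset.finite_toSet _).image _)).trans ?_
    refine (Set.ncard_image_le (Finset.finite_toSet _)).trans ?_
    rw [Set.ncard_coe_finset]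
    simp
  | prime_pow_mul a p n hp hpa hn ih =>
    have ha : a ≠ 0 := by rintro rfl; simp at hpa
    obtain ⟨q, hq, hqp, hqn⟩ := exists_q p hp
    have hs : {z : GaussianInt | z.norm = ((p^n*a : ℕ):ℤ)} ⊆
        ((fun x : (ℕ × ℕ) × GaussianInt => q^x.1.1 * (star q)^x.1.2 * x.2) ''
          (((Finset.range (n+1) ×ˢ Finset.range (n+1) : Finset (ℕ × ℕ)) : Set (ℕ×ℕ)) ×ˢ
            {z : GaussianInt | z.norm = a})) := by
      intro z hz
      obtain ⟨i, hi, j, hj, w, hw, h⟩ := param p hp q hq hqp hqn a hpa n z hz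
      refine ⟨((i,j),w), ⟨?_, hw⟩, h.symm⟩
      simp; omega
    have hf := (Finset.finite_toSet (Finset.range (n+1) ×ˢ Finset.range (n+1))).prod (fin_norm a)
    refine (Set.ncard_le_ncard hs (hf.image _)).trans ?_
    refine (Set.ncard_image_le hf).trans ?_
    rw [Set.ncard_prod, Set.ncard_coe_finset]
    rw [Nat.Coprime.card_divisors_mul (Nat.Coprime.pow_left _ ((Nat.Prime.coprime_iff_not_dvd hp).2 hpa)),
      Nat.divisors_prime_pow hp]
    simp
    calc _ ≤ (n+1)*(n+1) * (9 * a.divisors.card^2) := Nat.mul_le_mul_left _ (ih ha)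
      _ = _ := by ring

/-- divisor bound -/
lemma div_bound (k : ℕ) (hk : k ≠ 0) (T L : ℝ) (hT : 1 < T) (hL : (k:ℝ) ≤ 2^L) (hL0 : 0 ≤ L) :
    (k.divisors.card : ℝ) ≤ (L+1)^T * 2^(L / Real.logb 2 T) := by
  rw [Nat.card_divisors hk]
  push_cast
  have hlT : 0 < Real.logb 2 T := Real.logb_pos (by norm_num) hT
  set s := (Real.logb 2 T)⁻¹ with hs
  have hs0 : 0 < s := inv_pos.2 hlT
  have hTs : T^s = 2 := by
    rw [← Real.rpow_logb (b := 2) (by norm_num) (by norm_num) (show 0 < T by linarith), ← Real.rpow_mul (by norm_num), hs, mul_inv_cancel₀ hlT.ne', Real.rpow_one]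
  rw [← Finset.prod_filter_mul_prod_filter_not k.primeFactors (fun p : ℕ => (p:ℝ) ≤ T)]
  have hexp : ∀ p ∈ k.primeFactors, (k.factorization p : ℝ) ≤ L := by
    intro p hp
    have h2 := (Nat.prime_of_mem_primeFactors hp).two_le
    have h1 : 2 ^ k.factorization p ≤ k :=
      (Nat.pow_le_pow_left h2 _).trans (Nat.le_of_dvd (by omega) (Nat.ordProj_dvd k p))
    have h3 : (2:ℝ)^(k.factorization p : ℝ) ≤ 2^L := by
      rw [Real.rpow_natCast]; exact le_trans (by exact_mod_cast h1) hL
    exact (Real.rpow_le_rpow_left_iff (by norm_num)).1 h3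
  apply mul_le_mul
  · calc _ ≤ ∏ p ∈ k.primeFactors with ((p:ℕ):ℝ) ≤ T, (L+1) := by
          apply Finset.prod_le_prod
          · intros; positivity
          · intro p hp
            have := hexp p (Finset.mem_filter.1 hp).1
            linarith
      _ = (L+1)^(((k.primeFactors.filter (fun p : ℕ => (p:ℝ) ≤ T)).card : ℝ)) := by
          rw [Finset.prod_const, Real.rpow_natCast]
      _ ≤ _ := by
          apply Real.rpow_le_rpow_of_exponent_le (by linarith)
          have : (k.primeFactors.filter (fun p : ℕ => (p:ℝ) ≤ T)) ⊆ Finset.Icc 1 ⌊T⌋₊ := by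
            intro p hp
            have h := Finset.mem_filter.1 hp
            rw [Finset.mem_Icc]
            exact ⟨(Nat.prime_of_mem_primeFactors h.1).one_le, Nat.le_floor h.2⟩
          have := Finset.card_le_card this
          simp at this
          exact le_trans (by exact_mod_cast this) (Nat.floor_le (by linarith))
  · calc _ ≤ ∏ p ∈ k.primeFactors with ¬ ((p:ℕ):ℝ) ≤ T, (((p:ℝ)^(k.factorization p))^s) := by
          apply Finset.prod_le_prod
          · intros; positivity
          · intro p hp
            have hpT := not_le.1 (Finset.mem_filter.1 hp).2
            have h1 : ((k.factorization p : ℝ)+1) ≤ 2^(k.factorization p) := by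
              exact_mod_cast Nat.lt_two_pow_self
            refine h1.trans ?_
            nth_rw 1 [← hTs]
            rw [← Real.rpow_natCast, ← Real.rpow_natCast, ← Real.rpow_mul (by linarith), mul_comm, Real.rpow_mul (by linarith)]
            gcongr
      _ ≤ ∏ p ∈ k.primeFactors, (((p:ℝ)^(k.factorization p))^s) := by
          rw [← Finset.prod_filter_mul_prod_filter_not k.primeFactors (fun p : ℕ => (p:ℝ) ≤ T)]
          refine le_mul_of_one_le_left (Finset.prod_nonneg (by intros; positivity)) ?_
          refine Finset.one_le_prod ?_
          intro p hp
          replace hp := (Finset.mem_filter.1 hp).1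
          apply Real.one_le_rpow _ hs0.le
          apply one_le_pow₀
          exact_mod_cast (Nat.prime_of_mem_primeFactors hp).one_le
      _ = (k:ℝ)^s := by
          rw [Real.finsetProd_rpow _ _ (by intros; positivity)]
          congr 1
          have := Nat.prod_factorization_pow_eq_self hk
          conv_rhs => rw [← this]
          rw [Finsupp.prod]; push_cast; rfl
      _ ≤ (2^L)^s := by gcongr
      _ = _ := by rw [← Real.rpow_mul (by norm_num), hs, div_eq_mul_inv]
  · apply Finset.prod_nonneg; intros; positivity
  · positivity

lemma count_bound (r : ℝ) (hr : 4 < r) (k : ℕ) (hk : (k:ℝ) ≤ r^2) :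
    ({z : GaussianInt | z.norm = k}.ncard : ℝ) ≤
      2 ^ (396 * Real.logb 2 r / Real.logb 2 (Real.logb 2 r)) := by
  set l := Real.logb 2 r with hl
  have hr2 : r = 2^l := (Real.rpow_logb (by norm_num) (by norm_num) (by linarith)).symm
  have hl2 : 2 < l := by
    rw [hl, Real.lt_logb_iff_rpow_lt (by norm_num) (by linarith)]
    norm_num; linarith
  set u := Real.logb 2 l with hu
  have hlu : l = 2^u := (Real.rpow_logb (by norm_num) (by norm_num) (by linarith)).symm
  have hu1 : 1 < u := by
    rw [hu, Real.lt_logb_iff_rpow_lt (by norm_num) (by linarith)]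
    norm_num; linarith
  have hln : Real.log 2 > 1/2 := by have := Real.log_two_gt_d9; linarith
  -- u ^ 2 ≤ 64 √l
  have hul : u ≤ 8 * l^(1/4:ℝ) := by
    have h1 : Real.log l ≤ l^(1/4:ℝ) / (1/4) := Real.log_le_rpow_div (by linarith) (by norm_num)
    have h2 : u * Real.log 2 = Real.log l := by
      rw [hu, Real.logb]; field_simp
    nlinarith
  have hT2 : l^(1/4:ℝ) * l^(1/4:ℝ) = l^(1/2:ℝ) := by
    rw [← Real.rpow_add (by linarith)]; norm_num
  have hT4 : l^(1/2:ℝ) * l^(1/2:ℝ) = l := by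
    rw [← Real.rpow_add (by linarith)]; norm_num
  have hTpos : 0 < l^(1/2:ℝ) := Real.rpow_pos_of_pos (by linarith) _
  have hu2 : u^2 ≤ 64 * l^(1/2:ℝ) := by
    have : 0 < l^(1/4:ℝ) := Real.rpow_pos_of_pos (by linarith) _
    nlinarith
  have hmain : l^(1/2:ℝ) * (3*u) ≤ 192 * (l/u) := by
    rw [← mul_div_assoc, le_div_iff₀ (by linarith)]
    nlinarith
  have hlu1 : 1 ≤ l/u := by
    rw [le_div_iff₀ (by linarith), one_mul, hu, Real.logb_le_iff_le_rpow (by norm_num) (by linarith)]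
    have := one_add_mul_self_le_rpow_one_add (s := 1) (by norm_num) (p := l) (by linarith)
    norm_num at this
    linarith
  rcases Nat.eq_zero_or_pos k with rfl | hk0
  · have : {z : GaussianInt | z.norm = (0:ℕ)} = {0} := by
      ext z; simp [Zsqrtd.norm_eq_zero_iff]
    rw [this]
    simp
    apply Real.one_le_rpow (by norm_num)
    positivity
  have hd := div_bound k hk0.ne' (l^(1/2:ℝ)) (2*l)
    (Real.one_lt_rpow (by linarith) (by norm_num))
    (by rw [mul_comm, Real.rpow_mul (by norm_num), ← hr2]; exact_mod_cast hk) (by linarith)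
  have hlogT : Real.logb 2 (l^(1/2:ℝ)) = u/2 := by
    rw [Real.logb_rpow_eq_mul_logb_of_pos (by linarith)]; ring
  rw [hlogT] at hd
  have hL3 : 2*l+1 ≤ 2^(3*u) := by
    rw [mul_comm 3 u, Real.rpow_mul (by norm_num), ← hlu]
    have : l^(3:ℝ) = l^3 := by exact_mod_cast Real.rpow_natCast l 3
    rw [this]
    nlinarith [mul_pos (show 0 < l by linarith) (show 0 < l - 2 by linarith), mul_pos (show 0 < l by linarith) (mul_pos (show 0 < l by linarith) (show 0 < l - 2 by linarith))]
  have hd2 : (k.divisors.card : ℝ) ≤ 2^(196*(l/u)) := by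
    calc _ ≤ _ := hd
      _ ≤ (2^(3*u))^(l^(1/2:ℝ)) * 2^(2*l/(u/2)) := by
        gcongr
      _ = 2^(l^(1/2:ℝ)*(3*u) + 4*(l/u)) := by
        rw [← Real.rpow_mul (by norm_num), ← Real.rpow_add (by norm_num)]
        congr 1
        field_simp
        ring
      _ ≤ _ := by
        apply Real.rpow_le_rpow_of_exponent_le (by norm_num)
        linarith
  have hc : ({z : GaussianInt | z.norm = k}.ncard : ℝ) ≤ 9 * (k.divisors.card:ℝ)^2 := by
    exact_mod_cast norm_count k hk0.ne'
  calc _ ≤ _ := hc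
    _ ≤ 2^(4*(l/u)) * (2^(196*(l/u)))^2 := by
      refine mul_le_mul ?_ (pow_le_pow_left₀ (Nat.cast_nonneg _) hd2 2) (sq_nonneg _) (Real.rpow_nonneg (by norm_num) _)
      calc (9:ℝ) ≤ 2^(4:ℝ) := by norm_num
        _ ≤ _ := Real.rpow_le_rpow_of_exponent_le (by norm_num) (by linarith)
    _ = _ := by
      rw [← Real.rpow_natCast, ← Real.rpow_mul (by norm_num), ← Real.rpow_add (by norm_num)]
      congr 1
      push_cast; ring

lemma ball_fin (n : ℕ) (R : ℝ) : {y : Fin n → ℤ | ∑ i, ((y i : ℝ)) ^ 2 ≤ R ^ 2}.Finite := by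
  refine (Set.Finite.pi (fun _ : Fin n => Set.finite_Icc (-⌈|R|⌉) ⌈|R|⌉)).subset ?_
  intro y hy i _
  have h1 : ((y i : ℝ))^2 ≤ R^2 :=
    (Finset.single_le_sum (f := fun i => ((y i : ℝ))^2) (fun _ _ => sq_nonneg _) (Finset.mem_univ i)).trans hy
  have h2 := abs_le.1 ((sq_le_sq.1 h1).trans (Int.le_ceil |R|))
  rw [Set.mem_Icc]
  exact ⟨by exact_mod_cast h2.1, by exact_mod_cast h2.2⟩

/-- There is a constant `c₀ > 0` such that for every `d ≥ 3` and every real `r > 4` whose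
square is a nonnegative integer, the number of lattice points on the origin-centered sphere
of radius `r` in `ℝ^d` is at most `2 ^ (c₀ * log r / log log r)` times the number of lattice
points in the closed ball of radius `r` in `ℝ^(d-2)` (base-2 logarithms). -/
theorem lattice_points_on_sphere_bound :
    ∃ c₀ : ℝ, 0 < c₀ ∧ ∀ d : ℕ, 3 ≤ d → ∀ r : ℝ, 4 < r → (∃ m : ℕ, r ^ 2 = (m : ℝ)) →
      (Set.ncard {x : Fin d → ℤ | ∑ i, ((x i : ℝ)) ^ 2 = r ^ 2} : ℝ) ≤
        (2 : ℝ) ^ (c₀ * Real.logb 2 r / Real.logb 2 (Real.logb 2 r)) *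
          (Set.ncard {y : Fin (d - 2) → ℤ | ∑ i, ((y i : ℝ)) ^ 2 ≤ r ^ 2} : ℝ) := by
  refine ⟨396, by norm_num, ?_⟩
  intro d hd r hr ⟨m, hm⟩
  obtain ⟨n, rfl⟩ : ∃ n, d = n + 2 := ⟨d-2, by omega⟩
  rw [Nat.add_sub_cancel]
  set B := (2 : ℝ) ^ (396 * Real.logb 2 r / Real.logb 2 (Real.logb 2 r)) with hB
  have hB0 : 0 ≤ B := by positivity
  have hfb := ball_fin n r
  have hfs : {x : Fin (n+2) → ℤ | ∑ i, ((x i : ℝ)) ^ 2 = r ^ 2}.Finite :=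
    (ball_fin (n+2) r).subset (fun x hx => le_of_eq hx)
  rw [Set.ncard_eq_toFinset_card _ hfs, Set.ncard_eq_toFinset_card _ hfb]
  set f : (Fin (n+2) → ℤ) → (Fin n → ℤ) := fun x i => x i.succ.succ with hf
  have hmaps : ∀ x ∈ hfs.toFinset, f x ∈ hfb.toFinset := by
    intro x hx
    simp only [Set.Finite.mem_toFinset, Set.mem_ofPred_eq, Fin.sum_univ_succ] at hx ⊢
    simp only [hf]
    nlinarith [sq_nonneg ((x 0 : ℤ):ℝ), sq_nonneg ((x (Fin.succ 0) : ℤ):ℝ)]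
  have hfib : ∀ y ∈ hfb.toFinset, (({x ∈ hfs.toFinset | f x = y}).card : ℕ) ≤ ⌊B⌋₊ := by
    intro y hy
    apply Nat.le_floor
    simp only [Set.Finite.mem_toFinset, Set.mem_ofPred_eq] at hy
    have hy' : ∑ i, (y i)^2 ≤ (m:ℤ) := by rw [hm] at hy; exact_mod_cast hy
    obtain ⟨k, hk⟩ := Int.eq_ofNat_of_zero_le (sub_nonneg.2 hy')
    have hkm : (k:ℝ) ≤ r^2 := by
      rw [hm]
      have : (k:ℤ) ≤ m := by
        rw [← hk]; have : 0 ≤ ∑ i, (y i)^2 := Finset.sum_nonneg (fun _ _ => sq_nonneg _)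
        linarith
      exact_mod_cast this
    refine le_trans ?_ (count_bound r hr k hkm)
    rw [Nat.cast_le, ← Set.ncard_coe_finset]
    refine Set.ncard_le_ncard_of_injOn (fun x => (⟨x 0, x (Fin.succ 0)⟩ : GaussianInt)) ?_ ?_ (fin_norm k)
    · intro x hx
      simp only [Finset.coe_filter, Set.Finite.mem_toFinset, Set.mem_ofPred_eq] at hx
      obtain ⟨h1, h2⟩ := hx
      rw [hm] at h1
      have h1' : ∑ i, (x i)^2 = (m:ℤ) := by exact_mod_cast h1
      simp only [Fin.sum_univ_succ] at h1'
      subst h2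
      simp only [Set.mem_ofPred_eq, Zsqrtd.norm_def, ← hk, hf]
      linarith
    · intro a ha b hb hab
      simp only [Finset.coe_filter, Set.mem_ofPred_eq] at ha hb
      simp only [Zsqrtd.mk.injEq] at hab
      have h := ha.2.trans hb.2.symm
      funext i
      refine Fin.cases hab.1 (fun i => Fin.cases hab.2 (fun i => congrFun h i) i) i
  have h := Finset.card_le_mul_card_image_of_maps_to hmaps _ hfib
  calc _ ≤ ((⌊B⌋₊ * hfb.toFinset.card : ℕ) : ℝ) := by exact_mod_cast h
    _ ≤ _ := by
      push_cast
      gcongr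
      exact Nat.floor_le hB0
end
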